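/- arXiv:1402.4790 — 2 statements merged into one kernel-verified Lean document; each statement's English description precedes it below -/
import Mathlib

section
/- Let D be an EAS division ring, m, n, p, q be positive integers, and φ : M_{m×n}(D) → M_{p×q}(D) be an adjacency preserver such that φ(0) = 0 and φ is not degenerate with respect to 0. Then φ is standard. -/
open Matrix

variable {D : Type*} [DivisionRing D]

/-- The rank of a matrix over a division ring: the dimension of its row space,
i.e. of the left `D`-subspace of `D^n` spanned by the rows. -/
noncomputable def rowRank {m n : ℕ} (A : Matrix (Fin m) (Fin n) D) : ℕ :=
  Module.finrank D (Submodule.span D (Set.range fun i => A i))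

/-- Two matrices are adjacent if their difference has rank one. -/
def Adjacent {m n : ℕ} (A B : Matrix (Fin m) (Fin n) D) : Prop :=
  rowRank (A - B) = 1

/-- `R(x)`: the set of matrices of the form `ᵗu x` for a fixed row vector `x`. -/
def Rvec {m n : ℕ} (x : Fin n → D) : Set (Matrix (Fin m) (Fin n) D) :=
  { M | ∃ u : Fin m → D, ∀ i j, M i j = u i * x j }

/-- `L(ᵗy)`: the set of matrices of the form `ᵗy v` for a fixed column vector `ᵗy`. -/
def Lvec {m n : ℕ} (y : Fin m → D) : Set (Matrix (Fin m) (Fin n) D) :=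
  { M | ∃ v : Fin n → D, ∀ i j, M i j = y i * v j }

/-- `R_d`: the matrices whose row space is contained in `d`. -/
def Rsub {m n : ℕ} (d : Submodule D (Fin n → D)) : Set (Matrix (Fin m) (Fin n) D) :=
  { M | ∀ i, M i ∈ d }

/-- `L_e`: the matrices whose column space (a right subspace, i.e. a `Dᵐᵒᵖ`-submodule)
is contained in `e`. -/
def Lsub {m n : ℕ} (e : Submodule Dᵐᵒᵖ (Fin m → D)) : Set (Matrix (Fin m) (Fin n) D) :=
  { M | ∀ j, (fun i => M i j) ∈ e }

/-- The orthogonal set of a set `e` of column vectors. -/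
def perpSet {m : ℕ} (e : Set (Fin m → D)) : Set (Fin m → D) :=
  { u | ∀ v ∈ e, ∑ i, u i * v i = 0 }

/-- The `p × q` matrix with upper-left block `B` and zeros elsewhere. -/
def pad {m n : ℕ} (p q : ℕ) (B : Matrix (Fin m) (Fin n) D) :
    Matrix (Fin p) (Fin q) D :=
  Matrix.of fun i j =>
    if hi : (i : ℕ) < m then if hj : (j : ℕ) < n then B ⟨i, hi⟩ ⟨j, hj⟩ else 0 else 0

/-- `φ` is degenerate with respect to `A`. -/
def DegenerateAt {m n p q : ℕ} (φ : Matrix (Fin m) (Fin n) D → Matrix (Fin p) (Fin q) D)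
    (A : Matrix (Fin m) (Fin n) D) : Prop :=
  ∃ x : Fin p → D, x ≠ 0 ∧ ∃ y : Fin q → D, y ≠ 0 ∧
    ∀ M : Matrix (Fin m) (Fin n) D, rowRank M ≤ 1 →
      φ (A + M) - φ A ∈ Rvec y ∪ Lvec x

/-- `φ` is degenerate: degenerate with respect to every matrix. -/
def Degenerate {m n p q : ℕ} (φ : Matrix (Fin m) (Fin n) D → Matrix (Fin p) (Fin q) D) :
    Prop :=
  ∀ A, DegenerateAt φ A

/-- A map (sending `0` to `0`) is degenerate with respect to `0` iff it maps every matrix of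
rank at most one into `R(y) ∪ L(ᵗx)` for some nonzero `y`, `x`. -/
def DegZero {m n p q : ℕ} (φ : Matrix (Fin m) (Fin n) D → Matrix (Fin p) (Fin q) D) :
    Prop :=
  ∃ x : Fin p → D, x ≠ 0 ∧ ∃ y : Fin q → D, y ≠ 0 ∧
    ∀ M : Matrix (Fin m) (Fin n) D, rowRank M ≤ 1 → φ M ∈ Rvec y ∪ Lvec x

/-- A standard adjacency preserver. -/
def Standard {m n p q : ℕ} (φ : Matrix (Fin m) (Fin n) D → Matrix (Fin p) (Fin q) D) :
    Prop :=
  (m ≤ p ∧ n ≤ q ∧ ∃ τ : D ≃+* D, ∃ T : Matrix (Fin p) (Fin p) D,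
    ∃ S : Matrix (Fin q) (Fin q) D, ∃ R : Matrix (Fin p) (Fin q) D,
    IsUnit T ∧ IsUnit S ∧ ∀ A, φ A = T * pad p q (A.map τ) * S + R) ∨
  (n ≤ p ∧ m ≤ q ∧ ∃ σ : D → D, Function.Bijective σ ∧ σ 1 = 1 ∧
    (∀ a b, σ (a + b) = σ a + σ b) ∧ (∀ a b, σ (a * b) = σ b * σ a) ∧
    ∃ T : Matrix (Fin p) (Fin p) D, ∃ S : Matrix (Fin q) (Fin q) D,
    ∃ R : Matrix (Fin p) (Fin q) D, IsUnit T ∧ IsUnit S ∧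
    ∀ A, φ A = T * pad p q (A.map σ).transpose * S + R)

/-- A division ring is EAS if every (unital) ring endomorphism of it is surjective. -/
def EAS (D : Type*) [DivisionRing D] : Prop :=
  ∀ f : D →+* D, Function.Surjective f

/-- A set of matrices is adjacent if any two distinct members are adjacent. -/
def IsAdjacentSet {m n : ℕ} (S : Set (Matrix (Fin m) (Fin n) D)) : Prop :=
  ∀ A ∈ S, ∀ B ∈ S, A ≠ B → Adjacent A B

namespace AdjacencyPreserver

/-- Two vectors of a left `K`-module satisfy no nontrivial linear relation. -/
def Indep (K : Type*) {M : Type*} [DivisionRing K] [AddCommGroup M] [Module K M] (a b : M) : Prop :=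
  ∀ s t : K, s • a = t • b → s = 0 ∧ t = 0

/-- A matrix is the product of a nonzero column vector and a nonzero row vector. -/
def RankOne {ι κ K : Type*} [DivisionRing K] (M : Matrix ι κ K) : Prop :=
  ∃ x : ι → K, ∃ y : κ → K, x ≠ 0 ∧ y ≠ 0 ∧ M = vecMulVec x y

section Indep

variable {K M : Type*} [DivisionRing K] [AddCommGroup M] [Module K M] {a b : M}

theorem Indep.left_ne_zero (h : Indep K a b) : a ≠ 0 := by
  rintro rfl
  exact one_ne_zero (h 1 0 (by simp)).1

theorem Indep.symm (h : Indep K a b) : Indep K b a := fun s t e => (h t s e.symm).symm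

theorem Indep.right_ne_zero (h : Indep K a b) : b ≠ 0 := h.symm.left_ne_zero

theorem exists_smul_of_not_indep (h : ¬ Indep K a b) (hb : b ≠ 0) : ∃ c : K, a = c • b := by
  unfold Indep at h
  push Not at h
  obtain ⟨s, t, e, hst⟩ := h
  by_cases hs : s = 0
  · subst hs
    rw [zero_smul, eq_comm, smul_eq_zero] at e
    exact absurd (e.resolve_right hb) (hst rfl)
  · exact ⟨s⁻¹ * t, by rw [mul_smul, ← e, smul_smul, inv_mul_cancel₀ hs, one_smul]⟩

theorem Indep.not_smul (h : Indep K a b) (c : K) : a ≠ c • b := fun e =>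
  one_ne_zero (h 1 c (by rw [one_smul, e])).1

theorem indep_of_forall_ne_smul (hb : b ≠ 0) (h : ∀ c : K, a ≠ c • b) : Indep K a b := by
  by_contra hc
  obtain ⟨c, e⟩ := exists_smul_of_not_indep hc hb
  exact h c e

theorem Indep.ne (h : Indep K a b) : a ≠ b := fun e => h.not_smul 1 (by rw [e, one_smul])

theorem Indep.smul_left (h : Indep K a b) {c : K} (hc : c ≠ 0) : Indep K (c • a) b := by
  intro s t e
  rw [smul_smul] at e
  obtain ⟨h1, h2⟩ := h _ _ e
  exact ⟨(mul_eq_zero.1 h1).resolve_right hc, h2⟩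

theorem Indep.smul_right (h : Indep K a b) {c : K} (hc : c ≠ 0) : Indep K a (c • b) :=
  (h.symm.smul_left hc).symm

theorem Indep.of_smul_left {c : K} (h : Indep K (c • a) b) : Indep K a b := by
  have hc : c ≠ 0 := by
    rintro rfl
    exact h.left_ne_zero (zero_smul _ _)
  simpa [smul_smul, inv_mul_cancel₀ hc] using h.smul_left (inv_ne_zero hc)

theorem Indep.of_smul_right {c : K} (h : Indep K a (c • b)) : Indep K a b :=
  h.symm.of_smul_left.symm

theorem Indep.add_right (h : Indep K a b) (c : K) : Indep K a (b + c • a) := by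
  intro s t e
  have := h (s - t * c) t (by rw [sub_smul, e, smul_add, mul_smul]; abel)
  obtain ⟨h1, rfl⟩ := this
  simpa using h1

theorem Indep.coeff_eq (h : Indep K a b) {s t s' t' : K} (e : s • a + t • b = s' • a + t' • b) :
    s = s' ∧ t = t' := by
  have := h (s - s') (t' - t) (by
    rw [sub_smul, sub_smul, sub_eq_sub_iff_add_eq_add, e, add_comm])
  exact ⟨sub_eq_zero.1 this.1, (sub_eq_zero.1 this.2).symm⟩

/-- A vector parallel to both members of an independent pair vanishes. -/
theorem Indep.eq_zero_of_smul (h : Indep K a b) {v : M} {s t : K} (h1 : v = s • a)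
    (h2 : v = t • b) : v = 0 := by
  rw [h1, (h s t (h1 ▸ h2)).1, zero_smul]

end Indep

section RankOne

variable {ι κ K : Type*} [DivisionRing K]

theorem vecMulVec_zero_right (x : ι → K) : vecMulVec x (0 : κ → K) = 0 := by
  ext i j
  simp [vecMulVec_apply]

theorem vecMulVec_eq_zero_iff {x : ι → K} {y : κ → K} : vecMulVec x y = 0 ↔ x = 0 ∨ y = 0 := by
  constructor
  · intro h
    by_contra! hc
    obtain ⟨i, hi⟩ := Function.ne_iff.1 hc.1
    obtain ⟨j, hj⟩ := Function.ne_iff.1 hc.2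
    have := congrFun (congrFun h i) j
    exact mul_ne_zero hi hj this
  · rintro (rfl | rfl) <;> simp [vecMulVec_zero_right]

theorem RankOne.ne_zero {M : Matrix ι κ K} (h : RankOne M) : M ≠ 0 := by
  obtain ⟨x, y, hx, hy, rfl⟩ := h
  rw [Ne, vecMulVec_eq_zero_iff]
  tauto

theorem not_rankOne_zero : ¬ RankOne (0 : Matrix ι κ K) := fun h => h.ne_zero rfl

theorem rankOne_vecMulVec {x : ι → K} {y : κ → K} (hx : x ≠ 0) (hy : y ≠ 0) :
    RankOne (vecMulVec x y) := ⟨x, y, hx, hy, rfl⟩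

theorem vecMulVec_right_cancel {x x' : ι → K} {y : κ → K} (hy : y ≠ 0)
    (h : vecMulVec x y = vecMulVec x' y) : x = x' := by
  rw [← sub_eq_zero, ← sub_vecMulVec, vecMulVec_eq_zero_iff] at h
  exact sub_eq_zero.1 (h.resolve_right hy)

theorem op_smul_vecMulVec (c : K) (x : ι → K) (y : κ → K) :
    vecMulVec (MulOpposite.op c • x) y = vecMulVec x (c • y) := (vecMulVec_smul' x c y).symm

/-- Equal nonzero products of a column and a row have proportional factors. -/
theorem exists_smul_of_vecMulVec_eq {a a' : ι → K} {b b' : κ → K} (ha : a ≠ 0) (hb : b ≠ 0)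
    (h : vecMulVec a b = vecMulVec a' b') :
    ∃ c : K, c ≠ 0 ∧ a' = MulOpposite.op c • a ∧ b = c • b' := by
  obtain ⟨i, hi⟩ := Function.ne_iff.1 ha
  have e : b = ((a i)⁻¹ * a' i) • b' := by
    ext j
    have := congrFun (congrFun h i) j
    simp only [vecMulVec_apply] at this
    simp only [Pi.smul_apply, smul_eq_mul, mul_assoc, ← this]
    rw [inv_mul_cancel_left₀ hi]
  refine ⟨_, ?_, ?_, e⟩
  · intro h0
    rw [h0, zero_smul] at e
    exact hb e
  · have hb' : b' ≠ 0 := by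
      rintro rfl
      exact hb (by rw [e, smul_zero])
    refine vecMulVec_right_cancel hb' ?_
    rw [op_smul_vecMulVec, ← e, h]

/-- A sum of two products with independent columns and independent rows is not a product. -/
theorem vecMulVec_add_vecMulVec_ne {a₁ a₂ a : ι → K} {b₁ b₂ b : κ → K} (ha : Indep Kᵐᵒᵖ a₁ a₂)
    (hb : Indep K b₁ b₂) : vecMulVec a₁ b₁ + vecMulVec a₂ b₂ ≠ vecMulVec a b := by
  intro h
  have col : ∀ j, MulOpposite.op (b₁ j) • a₁ + MulOpposite.op (b₂ j) • a₂ =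
      MulOpposite.op (b j) • a := by
    intro j
    ext i
    exact congrFun (congrFun h i) j
  have hbne : b ≠ 0 := by
    rintro rfl
    refine hb.left_ne_zero (funext fun j => ?_)
    have := col j
    simp only [Pi.zero_apply, MulOpposite.op_zero, zero_smul] at this
    have := ha.coeff_eq (s' := 0) (t' := 0) (by simpa using this)
    simpa using this.1
  obtain ⟨k, hk⟩ := Function.ne_iff.1 hbne
  have ea : a = MulOpposite.op (b₁ k * (b k)⁻¹) • a₁ + MulOpposite.op (b₂ k * (b k)⁻¹) • a₂ := by
    have := congrArg (fun v => MulOpposite.op (b k)⁻¹ • v) (col k)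
    simp only [smul_add, smul_smul, ← MulOpposite.op_mul] at this
    rw [this, mul_inv_cancel₀ hk, MulOpposite.op_one, one_smul]
  have e : ∀ j, b₁ j = b₁ k * (b k)⁻¹ * b j ∧ b₂ j = b₂ k * (b k)⁻¹ * b j := by
    intro j
    have := col j
    rw [ea, smul_add, smul_smul, smul_smul, ← MulOpposite.op_mul, ← MulOpposite.op_mul] at this
    have := ha.coeff_eq this
    exact ⟨MulOpposite.op_injective this.1, MulOpposite.op_injective this.2⟩
  have e1 : b₁ = (b₁ k * (b k)⁻¹) • b := funext fun j => (e j).1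
  have e2 : b₂ = (b₂ k * (b k)⁻¹) • b := funext fun j => (e j).2
  have h2 : b₂ k * (b k)⁻¹ ≠ 0 := by
    intro h0
    rw [h0, zero_smul] at e2
    exact hb.right_ne_zero e2
  refine hb.not_smul ((b₁ k * (b k)⁻¹) * (b₂ k * (b k)⁻¹)⁻¹) ?_
  rw [mul_smul]
  nth_rewrite 2 [e2]
  rw [smul_smul, smul_smul, inv_mul_cancel_right₀ h2, ← e1]

theorem exists_smul_of_add {a₁ a₂ : ι → K} {b₁ b₂ : κ → K} (ha : a₂ ≠ 0) (hb : b₂ ≠ 0)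
    (h : RankOne (vecMulVec a₁ b₁ + vecMulVec a₂ b₂)) :
    (∃ c : K, a₁ = MulOpposite.op c • a₂) ∨ ∃ c : K, b₁ = c • b₂ := by
  obtain ⟨x, y, -, -, e⟩ := h
  by_contra! hc
  refine vecMulVec_add_vecMulVec_ne (indep_of_forall_ne_smul ha fun c => ?_)
    (indep_of_forall_ne_smul hb hc.2) e
  simpa using hc.1 c.unop

theorem exists_smul_of_sub {a₁ a₂ : ι → K} {b₁ b₂ : κ → K} (ha : a₂ ≠ 0) (hb : b₂ ≠ 0)
    (h : RankOne (vecMulVec a₁ b₁ - vecMulVec a₂ b₂)) :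
    (∃ c : K, a₁ = MulOpposite.op c • a₂) ∨ ∃ c : K, b₁ = c • b₂ := by
  rw [sub_eq_add_neg, ← vecMulVec_neg] at h
  rcases exists_smul_of_add ha (neg_ne_zero.2 hb) h with h | ⟨c, hc⟩
  · exact Or.inl h
  · exact Or.inr ⟨-c, by rw [hc]; simp⟩

theorem not_rankOne_add {a₁ a₂ : ι → K} {b₁ b₂ : κ → K} (ha : Indep Kᵐᵒᵖ a₁ a₂)
    (hb : Indep K b₁ b₂) : ¬ RankOne (vecMulVec a₁ b₁ + vecMulVec a₂ b₂) := by
  rintro ⟨x, y, -, -, e⟩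
  exact vecMulVec_add_vecMulVec_ne ha hb e

/-- A family of products of columns and rows, pairwise at distance at most one and not vanishing
identically, shares either a row direction or a column direction. -/
theorem common_row_or_column {α : Type*} (F : α → Matrix ι κ K) (i₀ : α)
    (hF : ∀ i, ∃ x y, F i = vecMulVec x y) (h₀ : F i₀ ≠ 0)
    (h : ∀ i j, F i ≠ F j → RankOne (F i - F j)) :
    (∃ y : κ → K, y ≠ 0 ∧ ∀ i, ∃ x, F i = vecMulVec x y) ∨
      ∃ x : ι → K, x ≠ 0 ∧ ∀ i, ∃ y, F i = vecMulVec x y := by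
  choose x y hxy using hF
  have hne : ∀ i, F i ≠ 0 → x i ≠ 0 ∧ y i ≠ 0 := fun i hi =>
    ⟨fun h0 => hi (by rw [hxy, h0, zero_vecMulVec]),
      fun h0 => hi (by rw [hxy, h0, vecMulVec_zero_right])⟩
  have dich : ∀ i j, F j ≠ 0 →
      (∃ c : K, x i = MulOpposite.op c • x j) ∨ ∃ c : K, y i = c • y j := by
    intro i j hj
    by_cases hij : F i = F j
    · have := exists_smul_of_vecMulVec_eq (hne j hj).1 (hne j hj).2
        (show vecMulVec (x j) (y j) = vecMulVec (x i) (y i) by rw [← hxy, ← hxy, hij])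
      obtain ⟨c, -, hc, -⟩ := this
      exact Or.inl ⟨c, hc⟩
    · have := h i j hij
      rw [hxy i, hxy j] at this
      exact exists_smul_of_sub (hne j hj).1 (hne j hj).2 this
  obtain ⟨hx0, hy0⟩ := hne i₀ h₀
  by_cases hall : ∀ i, F i ≠ 0 → ∃ c : K, x i = MulOpposite.op c • x i₀
  · right
    refine ⟨x i₀, hx0, fun i => ?_⟩
    by_cases hi : F i = 0
    · exact ⟨0, by rw [hi, vecMulVec_zero_right]⟩
    · obtain ⟨c, hc⟩ := hall i hi
      exact ⟨c • y i, by rw [hxy, hc, op_smul_vecMulVec]⟩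
  · left
    push Not at hall
    obtain ⟨i₁, hi₁, hx1⟩ := hall
    obtain ⟨d, hd⟩ := (dich i₁ i₀ h₀).resolve_left (by simpa using hx1)
    have hd0 : d ≠ 0 := by
      rintro rfl
      exact (hne i₁ hi₁).2 (by rw [hd, zero_smul])
    refine ⟨y i₀, hy0, fun i => ?_⟩
    suffices ∃ c : K, F i = 0 ∨ y i = c • y i₀ by
      obtain ⟨c, hc | hc⟩ := this
      · exact ⟨0, by rw [hc, zero_vecMulVec]⟩
      · exact ⟨MulOpposite.op c • x i, by rw [hxy, hc, op_smul_vecMulVec]⟩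
    by_cases hi : F i = 0
    · exact ⟨0, Or.inl hi⟩
    rcases dich i i₀ h₀ with ⟨c, hc⟩ | ⟨c, hc⟩
    · rcases dich i i₁ hi₁ with ⟨c', hc'⟩ | ⟨c', hc'⟩
      · exfalso
        have hc'0 : c' ≠ 0 := by
          rintro rfl
          exact (hne i hi).1 (by rw [hc', MulOpposite.op_zero, zero_smul])
        refine hx1 (c * c'⁻¹) ?_
        rw [MulOpposite.op_mul, mul_smul, ← hc, hc', smul_smul, ← MulOpposite.op_mul,
          mul_inv_cancel₀ hc'0, MulOpposite.op_one, one_smul]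
      · exact ⟨c' * d, Or.inr (by rw [hc', hd, smul_smul])⟩
    · exact ⟨c, Or.inr hc⟩

end RankOne

section FunctionalEquation

variable {E : Type*} [DivisionRing E]

/-- A Pexider-type equation on the nonzero elements of an infinite division ring `D`, with values
in a division ring into which every ring homomorphism from `D` is surjective, is solved only by
ring homomorphisms. -/
theorem exists_ringHom_of_pexider [Infinite D] (hsurj : ∀ τ : D →+* E, Function.Surjective τ)
    (p₁ p₂ R : D → E) (G : D → D → E) (hinj : Function.Injective p₁)
    (hne₁ : ∀ a, a ≠ 0 → p₁ a ≠ 0) (hne₂ : ∀ a, a ≠ 0 → p₂ a ≠ 0)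
    (h₁ : p₁ 1 = 1) (h₂ : p₂ 1 = 1)
    (h : ∀ c a b, c ≠ 0 → a ≠ 0 → b ≠ 0 → a + b ≠ 0 → p₁ a + R c * p₂ (c⁻¹ * b) = G c (a + b)) :
    ∃ τ : D →+* E, (∀ a, a ≠ 0 → p₁ a = τ a) ∧ (∀ a, a ≠ 0 → p₂ a = τ a) ∧ R 1 = 1 := by
  classical
  have hex : ∀ t : D, ∃ a : D, a ≠ 0 ∧ a + t ≠ 0 := by
    intro t
    obtain ⟨a, ha⟩ := Infinite.exists_notMem_finset ({0, -t} : Finset D)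
    simp only [Finset.mem_insert, Finset.mem_singleton, not_or] at ha
    exact ⟨a, ha.1, fun e => ha.2 (eq_neg_of_add_eq_zero_left e)⟩
  have key : ∀ c t a b : D, c ≠ 0 → a ≠ 0 → a + t ≠ 0 → b ≠ 0 → b - t ≠ 0 → a + b ≠ 0 →
      p₁ (a + t) + R c * p₂ (c⁻¹ * (b - t)) = p₁ a + R c * p₂ (c⁻¹ * b) := by
    intro c t a b hc ha hat hb hbt hab
    have e : a + t + (b - t) = a + b := by abel
    rw [h c a b hc ha hb hab, h c (a + t) (b - t) hc hat hbt (e ▸ hab), e]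
  let δ : D → E := fun t => p₁ ((hex t).choose + t) - p₁ (hex t).choose
  have hδ : ∀ t a : D, a ≠ 0 → a + t ≠ 0 → p₁ (a + t) - p₁ a = δ t := by
    intro t a ha hat
    obtain ⟨ha', hat'⟩ := (hex t).choose_spec
    set a' := (hex t).choose with ha'_def
    obtain ⟨b, hb⟩ := Infinite.exists_notMem_finset ({0, t, -a, -a'} : Finset D)
    simp only [Finset.mem_insert, Finset.mem_singleton, not_or] at hb
    obtain ⟨hb0, hbt, hba, hba'⟩ := hb
    have k1 := key 1 t a b one_ne_zero ha hat hb0 (sub_ne_zero.2 hbt)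
      (fun e => hba (eq_neg_of_add_eq_zero_right e))
    have k2 := key 1 t a' b one_ne_zero ha' hat' hb0 (sub_ne_zero.2 hbt)
      (fun e => hba' (eq_neg_of_add_eq_zero_right e))
    change _ = p₁ (a' + t) - p₁ a'
    rw [eq_sub_of_add_eq k1, eq_sub_of_add_eq k2]
    abel
  have hQ : ∀ c t b : D, c ≠ 0 → b ≠ 0 → b - t ≠ 0 →
      R c * (p₂ (c⁻¹ * b) - p₂ (c⁻¹ * (b - t))) = δ t := by
    intro c t b hc hb hbt
    obtain ⟨a, ha⟩ := Infinite.exists_notMem_finset ({0, -t, -b} : Finset D)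
    simp only [Finset.mem_insert, Finset.mem_singleton, not_or] at ha
    have hat : a + t ≠ 0 := fun e => ha.2.1 (eq_neg_of_add_eq_zero_left e)
    have k := key c t a b hc ha.1 hat hb hbt (fun e => ha.2.2 (eq_neg_of_add_eq_zero_left e))
    rw [← hδ t a ha.1 hat, mul_sub, sub_eq_sub_iff_add_eq_add, add_comm, ← k]
  have hadd : ∀ s t, δ (s + t) = δ s + δ t := by
    intro s t
    obtain ⟨a, ha⟩ := Infinite.exists_notMem_finset ({0, -t, -(s + t)} : Finset D)
    simp only [Finset.mem_insert, Finset.mem_singleton, not_or] at ha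
    have hat : a + t ≠ 0 := fun e => ha.2.1 (eq_neg_of_add_eq_zero_left e)
    have hast : a + (s + t) ≠ 0 := fun e => ha.2.2 (eq_neg_of_add_eq_zero_left e)
    have e : a + t + s = a + (s + t) := by abel
    rw [← hδ (s + t) a ha.1 hast, ← hδ t a ha.1 hat, ← hδ s (a + t) hat (e ▸ hast), e]
    abel
  have hδ1 : δ 1 ≠ 0 := by
    obtain ⟨a, ha, hat⟩ := hex 1
    rw [← hδ 1 a ha hat, sub_ne_zero]
    intro e
    simpa using hinj e
  have hR1 : R 1 ≠ 0 := by
    intro e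
    obtain ⟨b, hb⟩ := Infinite.exists_notMem_finset ({0, 1} : Finset D)
    simp only [Finset.mem_insert, Finset.mem_singleton, not_or] at hb
    have := hQ 1 1 b one_ne_zero hb.1 (sub_ne_zero.2 hb.2)
    rw [e, zero_mul] at this
    exact hδ1 this.symm
  have hscale : ∀ c t : D, c ≠ 0 → R c * ((R 1)⁻¹ * δ (c⁻¹ * t)) = δ t := by
    intro c t hc
    obtain ⟨b, hb⟩ := Infinite.exists_notMem_finset ({0, t} : Finset D)
    simp only [Finset.mem_insert, Finset.mem_singleton, not_or] at hb
    have hbt : b - t ≠ 0 := sub_ne_zero.2 hb.2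
    rw [← hQ c t b hc hb.1 hbt, ← hQ 1 (c⁻¹ * t) (c⁻¹ * b) one_ne_zero
      (mul_ne_zero (inv_ne_zero hc) hb.1)
      (by rw [← mul_sub]; exact mul_ne_zero (inv_ne_zero hc) hbt)]
    simp only [inv_mul_cancel_left₀ hR1, inv_one, one_mul, mul_sub]
  have hmul : ∀ c t, δ (c * t) * (δ 1)⁻¹ = δ c * (δ 1)⁻¹ * (δ t * (δ 1)⁻¹) := by
    intro c t
    have h0 : δ 0 = 0 := by simpa using hadd 0 0
    by_cases hc : c = 0
    · simp [hc, h0]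
    · have e1 := hscale c c hc
      have e2 := hscale c (c * t) hc
      rw [inv_mul_cancel₀ hc] at e1
      rw [inv_mul_cancel_left₀ hc] at e2
      have e3 : R c * (R 1)⁻¹ = δ c * (δ 1)⁻¹ := by
        rw [← e1, ← mul_assoc, mul_inv_cancel_right₀ hδ1]
      rw [← e2, ← mul_assoc, e3]
      simp only [mul_assoc]
  let τ : D →+* E := RingHom.mk' ⟨⟨fun t => δ t * (δ 1)⁻¹, mul_inv_cancel₀ hδ1⟩, hmul⟩
    (fun s t => by
      change δ (s + t) * (δ 1)⁻¹ = _
      rw [hadd, add_mul]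
      rfl)
  have hτ : ∀ t, δ t = τ t * δ 1 := fun t => by
    change _ = δ t * (δ 1)⁻¹ * δ 1
    rw [inv_mul_cancel_right₀ hδ1]
  have hδs : Function.Surjective δ := by
    intro e
    obtain ⟨t, ht⟩ := hsurj τ (e * (δ 1)⁻¹)
    exact ⟨t, by rw [hτ, ht, inv_mul_cancel_right₀ hδ1]⟩
  have hδ0 : δ 0 = 0 := by simpa using hadd 0 0
  have e1 : ∀ a, a ≠ 0 → p₁ a = δ a + (p₁ 1 - δ 1) := by
    intro a ha
    have := hδ (a - 1) 1 one_ne_zero (by simpa using ha)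
    have h' := hadd (a - 1) 1
    rw [sub_add_cancel] at h'
    rw [h', ← this]
    simp
  have k1 : p₁ 1 - δ 1 = 0 := by
    by_contra hk
    obtain ⟨a, ha⟩ := hδs (-(p₁ 1 - δ 1))
    have ha0 : a ≠ 0 := by
      rintro rfl
      rw [hδ0, eq_comm, neg_eq_zero] at ha
      exact hk ha
    exact hne₁ a ha0 (by rw [e1 a ha0, ha, neg_add_cancel])
  have hδ11 : δ 1 = 1 := by rw [← h₁]; exact (sub_eq_zero.1 k1).symm
  have e2 : ∀ a, a ≠ 0 → p₂ a = (R 1)⁻¹ * δ a + (p₂ 1 - (R 1)⁻¹ * δ 1) := by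
    intro a ha
    have := hQ 1 (a - 1) a one_ne_zero ha (by simp)
    have h' := hadd (a - 1) 1
    rw [sub_add_cancel] at h'
    rw [h', ← this, mul_add, inv_mul_cancel_left₀ hR1]
    simp
  have k2 : p₂ 1 - (R 1)⁻¹ * δ 1 = 0 := by
    by_contra hk
    obtain ⟨a, ha⟩ := hδs (-(R 1 * (p₂ 1 - (R 1)⁻¹ * δ 1)))
    have ha0 : a ≠ 0 := by
      rintro rfl
      rw [hδ0, eq_comm, neg_eq_zero] at ha
      exact mul_ne_zero hR1 hk ha
    exact hne₂ a ha0 (by rw [e2 a ha0, ha, mul_neg, inv_mul_cancel_left₀ hR1, neg_add_cancel])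
  have hR : R 1 = 1 := by
    have := sub_eq_zero.1 k2
    rw [h₂, hδ11, mul_one] at this
    rw [← inv_inv (R 1), ← this, inv_one]
  refine ⟨τ, fun a ha => ?_, fun a ha => ?_, hR⟩
  · rw [e1 a ha, k1, add_zero, hτ, hδ11, mul_one]
  · rw [e2 a ha, k2, add_zero, hτ, hδ11, mul_one, hR, inv_one, one_mul]

end FunctionalEquation

section Lineation

variable {E W Y : Type*} [DivisionRing E] [AddCommGroup W] [Module D W] [AddCommGroup Y]
  [Module E Y]

/-- An injective map of vector spaces fixing `0`, mapping lines through `0` into lines through `0`,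
and mapping every line that joins two points with independent images into a line. -/
structure IsLineation (D E : Type*) {W Y : Type*} [DivisionRing D] [DivisionRing E]
    [AddCommGroup W] [Module D W] [AddCommGroup Y] [Module E Y] (f : W → Y) : Prop where
  injective : Function.Injective f
  map_zero : f 0 = 0
  map_smul : ∀ (d : D) (w : W), ∃ c : E, f (d • w) = c • f w
  map_join : ∀ w w' : W, Indep E (f w) (f w') → ∀ s : D, ∃ c : E,
    f (s • w + (1 - s) • w') = c • f w + (1 - c) • f w'

variable {f : W → Y}

theorem IsLineation.ne_zero (hf : IsLineation D E f) {w : W} (hw : w ≠ 0) : f w ≠ 0 := fun h =>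
  hw (hf.injective (h.trans hf.map_zero.symm))

theorem IsLineation.indep_smul (hf : IsLineation D E f) {w w' : W} (h : Indep E (f w) (f w'))
    {a b : D} (ha : a ≠ 0) (hb : b ≠ 0) : Indep E (f (a • w)) (f (b • w')) := by
  have hne : ∀ (d : D) (v : W), d ≠ 0 → f v ≠ 0 → f (d • v) ≠ 0 := by
    intro d v hd hv
    refine hf.ne_zero (smul_ne_zero hd ?_)
    rintro rfl
    exact hv hf.map_zero
  have key : ∀ (d : D) (v : W), d ≠ 0 → f v ≠ 0 → ∃ c : E, c ≠ 0 ∧ f (d • v) = c • f v := by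
    intro d v hd hv
    obtain ⟨c, hc⟩ := hf.map_smul d v
    refine ⟨c, ?_, hc⟩
    rintro rfl
    exact hne d v hd hv (by rw [hc, zero_smul])
  obtain ⟨c, hc, ec⟩ := key a w ha h.left_ne_zero
  obtain ⟨c', hc', ec'⟩ := key b w' hb h.right_ne_zero
  rw [ec, ec']
  exact (h.smul_left hc).smul_right hc'

theorem IsLineation.exists_coeff (hf : IsLineation D E f) {w w' : W} (h : Indep E (f w) (f w'))
    {σ₁ σ₂ : D → E} (h₁ : ∀ d : D, f (d • w) = σ₁ d • f w) (h₂ : ∀ d : D, f (d • w') = σ₂ d • f w')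
    {x y s : D} (hx : x ≠ 0) (hy : y ≠ 0) (hs : s ≠ 0) (hs1 : s ≠ 1) :
    ∃ c : E, f (x • w + y • w') =
      (c * σ₁ (s⁻¹ * x)) • f w + ((1 - c) * σ₂ ((1 - s)⁻¹ * y)) • f w' := by
  have hs' : 1 - s ≠ 0 := sub_ne_zero.2 hs1.symm
  obtain ⟨c, hc⟩ := hf.map_join ((s⁻¹ * x) • w) (((1 - s)⁻¹ * y) • w')
    (hf.indep_smul h (mul_ne_zero (inv_ne_zero hs) hx) (mul_ne_zero (inv_ne_zero hs') hy)) s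
  refine ⟨c, ?_⟩
  rw [smul_smul, smul_smul, mul_inv_cancel_left₀ hs, mul_inv_cancel_left₀ hs', h₁, h₂, smul_smul,
    smul_smul] at hc
  exact hc

theorem IsLineation.add_of_infinite [Infinite D] (hf : IsLineation D E f)
    (hsurj : ∀ τ : D →+* E, Function.Surjective τ) {w w' : W} (h : Indep E (f w) (f w')) :
    f (w + w') = f w + f w' ∧ ∀ c : E, ∃ d : D, f (d • w) = c • f w := by
  choose σ₁ hσ₁ using fun d : D => hf.map_smul d w
  choose σ₂ hσ₂ using fun d : D => hf.map_smul d w'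
  have hw : w ≠ 0 := by
    rintro rfl
    exact h.left_ne_zero hf.map_zero
  have hw' : w' ≠ 0 := by
    rintro rfl
    exact h.right_ne_zero hf.map_zero
  have inj : ∀ (v : W) (σ : D → E), v ≠ 0 → (∀ d : D, f (d • v) = σ d • f v) →
      Function.Injective σ := by
    intro v σ hv hσ a b hab
    exact smul_left_injective D hv (hf.injective (by simp only [hσ, hab]))
  have zero : ∀ (v : W) (σ : D → E), v ≠ 0 → (∀ d : D, f (d • v) = σ d • f v) → σ 0 = 0 := by
    intro v σ hv hσ
    have := hσ 0
    rw [zero_smul, hf.map_zero, eq_comm, smul_eq_zero] at this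
    exact this.resolve_right (hf.ne_zero hv)
  have one : ∀ (v : W) (σ : D → E), v ≠ 0 → (∀ d : D, f (d • v) = σ d • f v) → σ 1 = 1 := by
    intro v σ hv hσ
    have := hσ 1
    rw [one_smul] at this
    exact smul_left_injective E (hf.ne_zero hv) (by simp [← this])
  have inj₁ := inj w σ₁ hw hσ₁
  have inj₂ := inj w' σ₂ hw' hσ₂
  have z₁ := zero w σ₁ hw hσ₁
  have z₂ := zero w' σ₂ hw' hσ₂
  have ne₁ : ∀ a, a ≠ 0 → σ₁ a ≠ 0 := fun a ha e => ha (inj₁ (e.trans z₁.symm))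
  have ne₂ : ∀ a, a ≠ 0 → σ₂ a ≠ 0 := fun a ha e => ha (inj₂ (e.trans z₂.symm))
  obtain ⟨s₀, hs₀⟩ := Infinite.exists_notMem_finset
    (Set.Finite.toFinset (Set.toFinite ({0, 1} : Set D)))
  simp only [Set.Finite.mem_toFinset, Set.mem_insert_iff, Set.mem_singleton_iff, not_or] at hs₀
  have hXY : ∀ x y : D, ∃ X Y : E, x ≠ 0 → y ≠ 0 → X ≠ 0 ∧
      f (x • w + y • w') = X • f w + Y • f w' ∧
      ∀ s : D, s ≠ 0 → s ≠ 1 → X * (σ₁ (s⁻¹ * x))⁻¹ + Y * (σ₂ ((1 - s)⁻¹ * y))⁻¹ = 1 := by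
    intro x y
    by_cases hx : x = 0
    · exact ⟨0, 0, fun h => absurd hx h⟩
    by_cases hy : y = 0
    · exact ⟨0, 0, fun _ h => absurd hy h⟩
    obtain ⟨c, hc⟩ := hf.exists_coeff h hσ₁ hσ₂ hx hy hs₀.1 hs₀.2
    refine ⟨_, _, fun _ _ => ⟨?_, hc, ?_⟩⟩
    · refine mul_ne_zero ?_ (ne₁ _ (mul_ne_zero (inv_ne_zero hs₀.1) hx))
      rintro rfl
      rw [zero_mul, zero_smul, zero_add, sub_zero, one_mul, ← hσ₂] at hc
      have e := hf.injective hc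
      have hxw : x • w = ((1 - s₀)⁻¹ * y - y) • w' := by rw [sub_smul, ← e, add_sub_cancel_right]
      have hw'' : w = (x⁻¹ * ((1 - s₀)⁻¹ * y - y)) • w' := by
        rw [mul_smul, ← hxw, smul_smul, inv_mul_cancel₀ hx, one_smul]
      obtain ⟨c, hc⟩ := hf.map_smul (x⁻¹ * ((1 - s₀)⁻¹ * y - y)) w'
      rw [← hw''] at hc
      exact h.not_smul c hc
    · intro s hs hs1
      obtain ⟨c', hc'⟩ := hf.exists_coeff h hσ₁ hσ₂ hx hy hs hs1
      obtain ⟨e1, e2⟩ := h.coeff_eq (hc.symm.trans hc')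
      rw [e1, e2, mul_inv_cancel_right₀ (ne₁ _ (mul_ne_zero (inv_ne_zero hs) hx)),
        mul_inv_cancel_right₀ (ne₂ _ (mul_ne_zero (inv_ne_zero (sub_ne_zero.2 hs1.symm)) hy))]
      abel
  choose X Y hXY using hXY
  obtain ⟨τ, hτ₁, hτ₂, hR⟩ := exists_ringHom_of_pexider hsurj (fun a => (σ₁ a⁻¹)⁻¹)
    (fun a => (σ₂ a⁻¹)⁻¹) (fun c => (X 1 c)⁻¹ * Y 1 c) (fun c a => (X a⁻¹ (a⁻¹ * c))⁻¹)
    (fun a b hab => inv_injective (inj₁ (inv_injective hab)))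
    (fun a ha => inv_ne_zero (ne₁ _ (inv_ne_zero ha)))
    (fun a ha => inv_ne_zero (ne₂ _ (inv_ne_zero ha)))
    (by simp [one w σ₁ hw hσ₁]) (by simp [one w' σ₂ hw' hσ₂])
    (by
      intro c a b hc ha hb hab
      obtain ⟨hX1, e1, -⟩ := hXY 1 c one_ne_zero hc
      obtain ⟨hX, e, hs⟩ := hXY (a + b)⁻¹ ((a + b)⁻¹ * c) (inv_ne_zero hab)
        (mul_ne_zero (inv_ne_zero hab) hc)
      obtain ⟨k, hk⟩ := hf.map_smul (a + b)⁻¹ ((1 : D) • w + c • w')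
      rw [smul_add, smul_smul, smul_smul, mul_one, e, e1, smul_add, smul_smul, smul_smul] at hk
      obtain ⟨k1, k2⟩ := h.coeff_eq hk
      have hk0 : k ≠ 0 := by
        rintro rfl
        exact hX (by rw [k1, zero_mul])
      have hR : (X 1 c)⁻¹ * Y 1 c =
          (X (a + b)⁻¹ ((a + b)⁻¹ * c))⁻¹ * Y (a + b)⁻¹ ((a + b)⁻¹ * c) := by
        rw [k1, k2, _root_.mul_inv_rev, mul_assoc, inv_mul_cancel_left₀ hk0]
      have hb' : 1 - (a + b)⁻¹ * a = (a + b)⁻¹ * b := by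
        rw [sub_eq_iff_eq_add, ← mul_add, add_comm b a, inv_mul_cancel₀ hab]
      have := hs ((a + b)⁻¹ * a) (mul_ne_zero (inv_ne_zero hab) ha) (by
        intro h1
        rw [h1, sub_self, eq_comm] at hb'
        exact mul_ne_zero (inv_ne_zero hab) hb hb')
      rw [hb', _root_.mul_inv_rev, _root_.mul_inv_rev, inv_inv, mul_assoc, mul_inv_cancel₀ hab,
        mul_one, mul_assoc, mul_inv_cancel_left₀ hab] at this
      rw [hR, _root_.mul_inv_rev, inv_inv]
      rw [← mul_right_inj' hX, mul_add, ← mul_assoc, ← mul_assoc, mul_inv_cancel₀ hX, one_mul,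
        this])
  have hσ₁τ : ∀ a, σ₁ a = τ a := by
    intro a
    by_cases ha : a = 0
    · rw [ha, z₁, _root_.map_zero τ]
    · have := hτ₁ a⁻¹ (inv_ne_zero ha)
      simp only [inv_inv, map_inv₀] at this
      exact inv_injective this
  have hσ₂τ : ∀ a, σ₂ a = τ a := by
    intro a
    by_cases ha : a = 0
    · rw [ha, z₂, _root_.map_zero τ]
    · have := hτ₂ a⁻¹ (inv_ne_zero ha)
      simp only [inv_inv, map_inv₀] at this
      exact inv_injective this
  constructor
  · obtain ⟨hX, e, hs⟩ := hXY 1 1 one_ne_zero one_ne_zero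
    have hYX : Y 1 1 = X 1 1 := by
      rw [← mul_one (X 1 1), ← hR, mul_inv_cancel_left₀ hX]
    have := hs s₀ hs₀.1 hs₀.2
    rw [hYX, hσ₁τ, hσ₂τ, mul_one, mul_one, map_inv₀, map_inv₀, inv_inv, inv_inv, ← mul_add,
      ← map_add, add_sub_cancel, map_one, mul_one] at this
    rw [one_smul, one_smul, hYX, this, one_smul, one_smul] at e
    exact e
  · intro c
    obtain ⟨d, hd⟩ := hsurj τ c
    exact ⟨d, by rw [hσ₁, hσ₁τ, hd]⟩

theorem IsLineation.add_of_finite [Finite D] (hf : IsLineation D E f) (e : D ≃ E)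
    (ht : ∃ t : D, t ≠ 0 ∧ t ≠ 1) {w w' : W} (h : Indep E (f w) (f w')) :
    f (w + w') = f w + f w' := by
  have surj : ∀ σ : D → E, Function.Injective σ → Function.Surjective σ := fun σ hσ =>
    (Finite.injective_iff_surjective_of_equiv e).1 hσ
  have line : ∀ w : W, w ≠ 0 → ∀ c : E, ∃ d : D, f (d • w) = c • f w := by
    intro w hw c
    choose σ hσ using fun d : D => hf.map_smul d w
    obtain ⟨d, hd⟩ := surj σ
      (fun a b hab => smul_left_injective D hw (hf.injective (by simp only [hσ, hab]))) c
    exact ⟨d, by rw [hσ, hd]⟩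
  have join : ∀ w w' : W, Indep E (f w) (f w') → ∀ c : E, ∃ s : D,
      f (s • w + (1 - s) • w') = c • f w + (1 - c) • f w' := by
    intro w w' h c
    choose σ hσ using hf.map_join w w' h
    have hne : w - w' ≠ 0 := by
      rw [sub_ne_zero]
      rintro rfl
      exact h.not_smul 1 (one_smul _ _).symm
    obtain ⟨s, hs⟩ := surj σ (fun a b hab => by
      have := hf.injective (a₁ := a • w + (1 - a) • w') (a₂ := b • w + (1 - b) • w')
        (by simp only [hσ, hab])
      refine smul_left_injective D hne ?_
      simp only [sub_smul, one_smul, smul_sub] at this ⊢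
      rw [← sub_eq_zero] at this ⊢
      rw [← this]
      abel) c
    exact ⟨s, by rw [hσ, hs]⟩
  have half : ∀ w w' : W, Indep E (f w) (f w') → ∃ c : E, f (w + w') = c • f w + f w' := by
    intro w w' h
    have hw : w ≠ 0 := by
      rintro rfl
      exact h.left_ne_zero hf.map_zero
    have hw' : w' ≠ 0 := by
      rintro rfl
      exact h.right_ne_zero hf.map_zero
    obtain ⟨t, ht0, ht1⟩ := ht
    choose σ₁ hσ₁ using fun d : D => hf.map_smul d w
    choose σ₂ hσ₂ using fun d : D => hf.map_smul d w'
    obtain ⟨c, hc⟩ := hf.exists_coeff h hσ₁ hσ₂ (one_ne_zero (α := D)) one_ne_zero ht0 ht1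
    rw [one_smul, one_smul] at hc
    set X := c * σ₁ (t⁻¹ * 1)
    set Z := (1 - c) * σ₂ ((1 - t)⁻¹ * 1)
    suffices hZ : Z = 1 from ⟨X, by rw [hc, hZ, one_smul]⟩
    by_contra hZ
    have hZ' : 1 - Z ≠ 0 := sub_ne_zero.2 (Ne.symm hZ)
    have hind : Indep E (f (w + w')) (f w') := by
      refine indep_of_forall_ne_smul h.right_ne_zero fun k hk => ?_
      obtain ⟨d, hd⟩ := line w' hw' k
      have hww := hf.injective (hk.trans hd.symm)
      have : w = (d - 1) • w' := by rw [sub_smul, ← hww, one_smul, add_sub_cancel_right]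
      rw [this, hσ₂] at h
      exact h.not_smul _ rfl
    obtain ⟨r, hr⟩ := join _ _ hind (1 - Z)⁻¹
    obtain ⟨d, hd⟩ := line w hw ((1 - Z)⁻¹ * X)
    have h0 : (1 - Z)⁻¹ * Z + (1 - (1 - Z)⁻¹) = 0 := by
      have : (1 - Z)⁻¹ * (1 - Z) = 1 := inv_mul_cancel₀ hZ'
      rw [mul_sub, mul_one] at this
      rw [← sub_eq_zero] at this
      rw [← neg_eq_zero, ← this]
      abel
    rw [hc, smul_add (1 - Z)⁻¹, smul_smul, smul_smul, add_assoc, ← add_smul, h0, zero_smul,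
      add_zero, ← hd] at hr
    have hrd := hf.injective hr
    have : w' = (d - r) • w := by
      rw [sub_smul, ← hrd, smul_add, sub_smul, one_smul]
      abel
    rw [this, hσ₁] at h
    exact h.symm.not_smul _ rfl
  obtain ⟨c, hc⟩ := half w w' h
  obtain ⟨c', hc'⟩ := half w' w h.symm
  have := h.coeff_eq (s := c) (t := 1) (s' := 1) (t' := c') (by
    rw [one_smul, one_smul, ← hc, add_comm w, hc', add_comm])
  rw [hc, this.1, one_smul]

/-- An injective map which maps lines through `0` onto lines through `0` and is additive on pairs
with independent images is semilinear. -/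
theorem exists_ringEquiv_of_add (hinj : Function.Injective f) (h0 : f 0 = 0)
    (hsmul : ∀ (d : D) (w : W), ∃ c : E, f (d • w) = c • f w)
    (hline : ∀ (w : W) (c : E), ∃ d : D, f (d • w) = c • f w)
    (hadd : ∀ w w', Indep E (f w) (f w') → f (w + w') = f w + f w')
    (hind : ∃ w w', Indep E (f w) (f w')) :
    ∃ τ : D ≃+* E, (∀ w w', f (w + w') = f w + f w') ∧
      ∀ (d : D) (w : W), f (d • w) = τ d • f w := by
  have hne : ∀ w, w ≠ 0 → f w ≠ 0 := fun w hw e => hw (hinj (e.trans h0.symm))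
  have ind : ∀ a b : W, b ≠ 0 → (∀ d : D, a ≠ d • b) → Indep E (f a) (f b) := by
    intro a b hb h
    refine indep_of_forall_ne_smul (hne b hb) fun c hc => ?_
    obtain ⟨d, hd⟩ := hline b c
    exact h d (hinj (hc.trans hd.symm))
  have add' : ∀ a b : W, (∀ d : D, a ≠ d • b) → f (a + b) = f a + f b := by
    intro a b h
    by_cases hb : b = 0
    · rw [hb, h0, add_zero, add_zero]
    · exact hadd _ _ (ind a b hb h)
  obtain ⟨w₁, w₂, h₁₂⟩ := hind
  have other : ∀ w : W, ∃ v : W, ∀ d : D, v ≠ d • w := by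
    intro w
    by_contra! hc
    obtain ⟨d₁, hd₁⟩ := hc w₁
    obtain ⟨d₂, hd₂⟩ := hc w₂
    obtain ⟨c₁, hc₁⟩ := hsmul d₁ w
    obtain ⟨c₂, hc₂⟩ := hsmul d₂ w
    rw [← hd₁] at hc₁
    rw [← hd₂] at hc₂
    rw [hc₁, hc₂] at h₁₂
    exact h₁₂.of_smul_left.of_smul_right.not_smul 1 (one_smul _ _).symm
  have add : ∀ w w', f (w + w') = f w + f w' := by
    intro w w'
    by_cases hw : ∀ d : D, w' ≠ d • w
    · rw [add_comm w, add' _ _ hw, add_comm]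
    push Not at hw
    obtain ⟨d, rfl⟩ := hw
    obtain ⟨v, hv⟩ := other w
    have hvm : ∀ e : D, f (v + e • w) = f v + f (e • w) := fun e =>
      add' _ _ fun k hk => hv (k * e) (by rw [hk, smul_smul])
    have e1 := hvm d
    have e2 := hvm (1 + d)
    have e3 := add' (v + d • w) w fun k hk => hv (k - d) (by
      rw [sub_smul, ← hk, add_sub_cancel_right])
    rw [add_smul, one_smul] at e2
    rw [e1, add_assoc v, add_comm (d • w) w, e2, add_assoc] at e3
    rw [add_left_cancel e3, add_comm]
  choose σ hσ using hsmul
  have hσeq : ∀ (d : D) (w w' : W), Indep E (f w) (f w') → σ d w = σ d w' := by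
    intro d w w' h
    have := hσ d (w + w')
    rw [smul_add, add, add, smul_add, hσ, hσ] at this
    obtain ⟨e1, e2⟩ := h.coeff_eq this
    rw [e1, e2]
  have hw₁ : f w₁ ≠ 0 := h₁₂.left_ne_zero
  have hsm : ∀ (d : D) (w : W), f (d • w) = σ d w₁ • f w := by
    intro d w
    by_cases hw : w = 0
    · rw [hw, smul_zero, h0, smul_zero]
    by_cases h : Indep E (f w) (f w₁)
    · rw [hσ, hσeq d w w₁ h]
    · obtain ⟨c, hc⟩ := exists_smul_of_not_indep h hw₁
      have : Indep E (f w) (f w₂) := by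
        rw [hc]
        refine h₁₂.smul_left ?_
        rintro rfl
        exact hne w hw (by rw [hc, zero_smul])
      rw [hσ, hσeq d w w₂ this, hσeq d w₁ w₂ h₁₂]
  have cancel : ∀ a b : E, a • f w₁ = b • f w₁ → a = b := fun a b h =>
    smul_left_injective E hw₁ h
  let τ : D →+* E := RingHom.mk' ⟨⟨fun d => σ d w₁, cancel _ _ (by rw [← hsm, one_smul, one_smul])⟩,
    fun a b => cancel _ _ (by
      change σ (a * b) w₁ • f w₁ = (σ a w₁ * σ b w₁) • f w₁
      rw [mul_smul, ← hsm, ← hsm, ← hsm, mul_smul])⟩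
    (fun a b => cancel _ _ (by
      change σ (a + b) w₁ • f w₁ = (σ a w₁ + σ b w₁) • f w₁
      rw [add_smul, ← hsm, ← hsm, ← hsm, add_smul, add]))
  have hτ : Function.Bijective τ := by
    refine ⟨τ.injective, fun c => ?_⟩
    obtain ⟨d, hd⟩ := hline w₁ c
    exact ⟨d, cancel _ _ (by rw [← hd, hsm]; rfl)⟩
  exact ⟨RingEquiv.ofBijective τ hτ, add, hsm⟩

end Lineation

section Frame

variable {E ι κ ι' κ' : Type*} [DivisionRing E]

theorem exists_smul_symm {K M : Type*} [DivisionRing K] [AddCommGroup M] [Module K M] {a b : M}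
    (ha : a ≠ 0) (h : ∃ c : K, a = c • b) : ∃ c : K, b = c • a := by
  obtain ⟨c, rfl⟩ := h
  have hc : c ≠ 0 := by
    rintro rfl
    exact ha (zero_smul _ _)
  exact ⟨c⁻¹, by rw [smul_smul, inv_mul_cancel₀ hc, one_smul]⟩

theorem exists_smul_trans {K M : Type*} [DivisionRing K] [AddCommGroup M] [Module K M] {a b c : M}
    (h : ∃ k : K, a = k • b) (h' : ∃ k : K, b = k • c) : ∃ k : K, a = k • c := by
  obtain ⟨k, rfl⟩ := h
  obtain ⟨l, rfl⟩ := h'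
  exact ⟨k * l, by rw [mul_smul]⟩

/-- A matrix adjacent to `x y` either has columns parallel to `x` or differs from `x y` by a
product with a column independent of `x`. -/
theorem eq_vecMulVec_or_of_rankOne_sub {x : ι → D} {y : κ → D} {C : Matrix ι κ D} (hx : x ≠ 0)
    (h : RankOne (C - vecMulVec x y)) :
    (∃ t, C = vecMulVec x t) ∨
      ∃ s t, t ≠ 0 ∧ Indep Dᵐᵒᵖ s x ∧ C = vecMulVec x y + vecMulVec s t := by
  obtain ⟨s, t, hs, ht, e⟩ := h
  rw [sub_eq_iff_eq_add'] at e
  by_cases hi : Indep Dᵐᵒᵖ s x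
  · exact Or.inr ⟨s, t, ht, hi, e⟩
  · obtain ⟨c, rfl⟩ := exists_smul_of_not_indep hi hx
    refine Or.inl ⟨y + c.unop • t, ?_⟩
    rw [e, vecMulVec_add, ← op_smul_vecMulVec, MulOpposite.op_unop]

theorem exists_smul_of_rankOne_sub {x s : ι → D} {y y' t : κ → D} (hs : Indep Dᵐᵒᵖ s x)
    (ht : t ≠ 0) (h : RankOne (vecMulVec x y + vecMulVec s t - vecMulVec x y')) :
    ∃ c : D, y - y' = c • t := by
  have : vecMulVec x y + vecMulVec s t - vecMulVec x y' =
      vecMulVec x (y - y') + vecMulVec s t := by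
    rw [vecMulVec_sub]
    abel
  rw [this] at h
  by_contra! hc
  exact not_rankOne_add hs.symm (indep_of_forall_ne_smul ht hc) h

theorem eq_zero_of_rankOne_sub {x x' : ι → D} {y y₁ y₂ y₃ y₄ z z' : κ → D} {C : Matrix ι κ D}
    (hx : Indep Dᵐᵒᵖ x x') (hz : Indep D z z')
    (h : RankOne (C - vecMulVec x y)) (h₁ : RankOne (C - vecMulVec x y₁)) (hy : y ≠ y₁)
    (hyz : ∃ c : D, y = c • z) (hyz₁ : ∃ c : D, y₁ = c • z)
    (h₂ : RankOne (C - vecMulVec x' y₂)) (hy₂ : y₂ ≠ 0) (hyz₂ : ∃ c : D, y₂ = c • z')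
    (h₃ : RankOne (C - vecMulVec x' y₃)) (hy₃ : y₃ ≠ 0) (hyz₃ : ∃ c : D, y₃ = c • z)
    (h₄ : RankOne (C - vecMulVec x y₄)) (hy₄ : y₄ ≠ 0) (hyz₄ : ∃ c : D, y₄ = c • z') : C = 0 := by
  have hC : ∃ t, C = vecMulVec x t := by
    rcases eq_vecMulVec_or_of_rankOne_sub hx.left_ne_zero h with hC | ⟨s, t, ht, hs, rfl⟩
    · exact hC
    · exfalso
      obtain ⟨c, rfl⟩ := hyz
      obtain ⟨c₁, rfl⟩ := hyz₁
      have ht1 := exists_smul_symm (sub_ne_zero.2 hy) (exists_smul_of_rankOne_sub hs ht h₁)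
      have ht2 := exists_smul_of_rankOne_sub hs ht h₄
      rw [← sub_smul] at ht1
      obtain ⟨k, hk⟩ := ht1
      obtain ⟨l, hl⟩ := ht2
      obtain ⟨c₄, rfl⟩ := hyz₄
      rw [hk, smul_smul, smul_smul, sub_eq_iff_eq_add', ← sub_eq_iff_eq_add, ← sub_smul] at hl
      exact hy₄ (by rw [← hl, (hz _ _ hl).1, zero_smul])
  obtain ⟨t, rfl⟩ := hC
  have par : ∀ y', y' ≠ 0 → RankOne (vecMulVec x t - vecMulVec x' y') → ∃ c : D, t = c • y' := by
    intro y' hy' hr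
    rcases exists_smul_of_sub hx.right_ne_zero hy' hr with ⟨c, hc⟩ | hc
    · exact absurd hc (hx.not_smul _)
    · exact hc
  obtain ⟨k, hk⟩ := exists_smul_trans (par _ hy₂ h₂) hyz₂
  obtain ⟨l, hl⟩ := exists_smul_trans (par _ hy₃ h₃) hyz₃
  rw [hz.eq_zero_of_smul hl hk, vecMulVec_zero_right]

/-- An adjacency preserver fixing `0` that maps products with column `u` to products with column
`h u` and products with row `w` to products with row `g w`, where neither the direction of `h` nor
that of `g` is constant. -/
structure Frame (φ : Matrix ι κ D → Matrix ι' κ' E) (h : (ι → D) → ι' → E) (g : (κ → D) → κ' → E)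
    (f : (ι → D) → (κ → D) → κ' → E) : Prop where
  adj : ∀ A B, RankOne (A - B) → RankOne (φ A - φ B)
  zero : φ 0 = 0
  col : ∀ u w, u ≠ 0 → φ (vecMulVec u w) = vecMulVec (h u) (f u w)
  col_ne : ∀ u, u ≠ 0 → h u ≠ 0
  row_ne : ∀ w, w ≠ 0 → g w ≠ 0
  row : ∀ u w, u ≠ 0 → w ≠ 0 → ∃ c : E, f u w = c • g w
  exists_col : ∃ u₁ u₂, u₁ ≠ 0 ∧ u₂ ≠ 0 ∧ Indep Eᵐᵒᵖ (h u₁) (h u₂)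
  exists_row : ∃ w₁ w₂, w₁ ≠ 0 ∧ w₂ ≠ 0 ∧ Indep E (g w₁) (g w₂)

theorem exists_indep_of_indep {K M : Type*} [DivisionRing K] [AddCommGroup M] [Module K M]
    {a b c : M} (h : Indep K a b) (hc : c ≠ 0) : Indep K c a ∨ Indep K c b := by
  by_contra! hn
  obtain ⟨k, hk⟩ := exists_smul_of_not_indep (fun e => hn.1 e.symm) hc
  obtain ⟨l, hl⟩ := exists_smul_of_not_indep (fun e => hn.2 e.symm) hc
  rw [hk, hl] at h
  exact h.of_smul_left.of_smul_right.not_smul 1 (one_smul _ _).symm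

namespace Frame

variable {φ : Matrix ι κ D → Matrix ι' κ' E} {h : (ι → D) → ι' → E} {g : (κ → D) → κ' → E}
  {f : (ι → D) → (κ → D) → κ' → E}

theorem coeff_zero (hφ : Frame φ h g f) {u : ι → D} (hu : u ≠ 0) : f u 0 = 0 := by
  have := hφ.col u 0 hu
  rw [vecMulVec_zero_right, hφ.zero, eq_comm, vecMulVec_eq_zero_iff] at this
  exact this.resolve_left (hφ.col_ne u hu)

theorem injective (hφ : Frame φ h g f) {u : ι → D} (hu : u ≠ 0) : Function.Injective (f u) := by
  intro w w' e
  by_contra hne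
  have := hφ.adj (vecMulVec u w) (vecMulVec u w') (by
    rw [← vecMulVec_sub]
    exact rankOne_vecMulVec hu (sub_ne_zero.2 hne))
  rw [hφ.col _ _ hu, hφ.col _ _ hu, e, sub_self] at this
  exact not_rankOne_zero this

theorem coeff_ne_zero (hφ : Frame φ h g f) {u : ι → D} {w : κ → D} (hu : u ≠ 0) (hw : w ≠ 0) :
    f u w ≠ 0 := fun e => hw (hφ.injective hu (e.trans (hφ.coeff_zero hu).symm))

theorem row' (hφ : Frame φ h g f) {u : ι → D} {w : κ → D} (hu : u ≠ 0) (hw : w ≠ 0) :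
    ∃ c : E, g w = c • f u w :=
  exists_smul_symm (hφ.coeff_ne_zero hu hw) (hφ.row u w hu hw)

theorem exists_col_indep (hφ : Frame φ h g f) {u : ι → D} (hu : u ≠ 0) :
    ∃ u', u' ≠ 0 ∧ Indep Eᵐᵒᵖ (h u) (h u') := by
  obtain ⟨u₁, u₂, h₁, h₂, hi⟩ := hφ.exists_col
  rcases exists_indep_of_indep hi (hφ.col_ne u hu) with h | h
  exacts [⟨u₁, h₁, h⟩, ⟨u₂, h₂, h⟩]

theorem exists_row_indep (hφ : Frame φ h g f) {w : κ → D} (hw : w ≠ 0) :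
    ∃ w', w' ≠ 0 ∧ Indep E (g w) (g w') := by
  obtain ⟨u₁, u₂, h₁, h₂, hi⟩ := hφ.exists_row
  rcases exists_indep_of_indep hi (hφ.row_ne w hw) with h | h
  exacts [⟨u₁, h₁, h⟩, ⟨u₂, h₂, h⟩]

theorem indep_coeff (hφ : Frame φ h g f) {u : ι → D} {w w' : κ → D} (hu : u ≠ 0) (hw : w ≠ 0)
    (hw' : w' ≠ 0) (hi : Indep E (g w) (g w')) : Indep E (f u w) (f u w') := by
  obtain ⟨c, hc⟩ := hφ.row' hu hw
  obtain ⟨c', hc'⟩ := hφ.row' hu hw'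
  rw [hc, hc'] at hi
  exact hi.of_smul_left.of_smul_right

theorem indep_row (hφ : Frame φ h g f) {u : ι → D} {w w' : κ → D} (hu : u ≠ 0) (hw : w ≠ 0)
    (hw' : w' ≠ 0) (hi : Indep E (f u w) (f u w')) : Indep E (g w) (g w') := by
  obtain ⟨c, hc⟩ := hφ.row _ _ hu hw
  obtain ⟨c', hc'⟩ := hφ.row _ _ hu hw'
  rw [hc, hc'] at hi
  exact hi.of_smul_left.of_smul_right

theorem op_smul_ne_zero {d : D} {u : ι → D} (hd : d ≠ 0) (hu : u ≠ 0) :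
    MulOpposite.op d • u ≠ 0 := smul_ne_zero (by simpa using hd) hu

theorem vecMulVec_eq (hφ : Frame φ h g f) {u : ι → D} {d : D} (hu : u ≠ 0) (hd : d ≠ 0)
    (w : κ → D) :
    vecMulVec (h u) (f u (d • w)) =
      vecMulVec (h (MulOpposite.op d • u)) (f (MulOpposite.op d • u) w) := by
  rw [← hφ.col _ _ hu, ← hφ.col _ _ (op_smul_ne_zero hd hu), op_smul_vecMulVec]

theorem row_smul (hφ : Frame φ h g f) {w : κ → D} {d : D} (hw : w ≠ 0) (hd : d ≠ 0) :
    ∃ c : E, g (d • w) = c • g w := by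
  obtain ⟨u, -, hu, -⟩ := hφ.exists_col
  obtain ⟨c, -, -, hc⟩ := exists_smul_of_vecMulVec_eq (hφ.col_ne u hu)
    (hφ.coeff_ne_zero hu (smul_ne_zero hd hw)) (hφ.vecMulVec_eq hu hd w)
  exact exists_smul_trans (hφ.row' hu (smul_ne_zero hd hw))
    (exists_smul_trans ⟨c, hc⟩ (hφ.row _ _ (op_smul_ne_zero hd hu) hw))

theorem col_smul (hφ : Frame φ h g f) {u : ι → D} {d : D} (hu : u ≠ 0) (hd : d ≠ 0) :
    ∃ c : Eᵐᵒᵖ, c ≠ 0 ∧ h (MulOpposite.op d • u) = c • h u := by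
  obtain ⟨w, -, hw, -⟩ := hφ.exists_row
  obtain ⟨c, hc0, hc, -⟩ := exists_smul_of_vecMulVec_eq (hφ.col_ne u hu)
    (hφ.coeff_ne_zero hu (smul_ne_zero hd hw)) (hφ.vecMulVec_eq hu hd w)
  exact ⟨MulOpposite.op c, by simpa using hc0, hc⟩

theorem coeff_smul (hφ : Frame φ h g f) {u : ι → D} (hu : u ≠ 0) (d : D) (w : κ → D) :
    ∃ c : E, f u (d • w) = c • f u w := by
  by_cases hd : d = 0
  · exact ⟨0, by rw [hd, zero_smul, zero_smul, hφ.coeff_zero hu]⟩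
  by_cases hw : w = 0
  · exact ⟨0, by rw [hw, smul_zero, zero_smul, hφ.coeff_zero hu]⟩
  · exact exists_smul_trans (hφ.row _ _ hu (smul_ne_zero hd hw))
      (exists_smul_trans (hφ.row_smul hw hd) (hφ.row' hu hw))

/-- Adjacency with products transfers along `φ`. -/
theorem adj_vecMulVec (hφ : Frame φ h g f) {u a : ι → D} {w b : κ → D} {A : Matrix ι κ D}
    (hu : u ≠ 0) (ha : a ≠ 0) (hb : b ≠ 0) (e : A - vecMulVec u w = vecMulVec a b) :
    RankOne (φ A - vecMulVec (h u) (f u w)) := by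
  rw [← hφ.col _ _ hu]
  exact hφ.adj _ _ (e ▸ rankOne_vecMulVec ha hb)

theorem ne_op_smul (hφ : Frame φ h g f) {u u' : ι → D} (hu : u ≠ 0) (hu' : u' ≠ 0)
    (hi : Indep Eᵐᵒᵖ (h u) (h u')) (d : D) : u ≠ MulOpposite.op d • u' := by
  rintro rfl
  have hd : d ≠ 0 := by
    rintro rfl
    exact hu (by simp)
  obtain ⟨c, -, hc⟩ := hφ.col_smul hu' hd
  exact hi.not_smul c hc

theorem indep_of_coeff (hφ : Frame φ h g f) {u : ι → D} {w w' : κ → D} (hu : u ≠ 0)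
    (hi : Indep E (f u w) (f u w')) : Indep D w w' := by
  have hw' : w' ≠ 0 := by
    rintro rfl
    exact hi.right_ne_zero (hφ.coeff_zero hu)
  refine indep_of_forall_ne_smul hw' ?_
  rintro d rfl
  obtain ⟨c, hc⟩ := hφ.coeff_smul hu d w'
  exact hi.not_smul c hc

theorem map_eq_zero (hφ : Frame φ h g f) {u u' : ι → D} {w w' : κ → D} {z z' : κ' → E}
    (hu : u ≠ 0) (hu' : u' ≠ 0) (hw : w ≠ 0) (hw' : w' ≠ 0) (hww : w + w' ≠ 0) (hne : w ≠ w')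
    (hi : Indep Eᵐᵒᵖ (h u) (h u')) (hz : Indep E z z') (h₁ : ∃ c : E, g w = c • z)
    (h₂ : ∃ c : E, g w' = c • z') (h₃ : ∃ c : E, g (w + w') = c • z)
    (h₄ : ∃ c : Eᵐᵒᵖ, h (u + u') = c • h u) : φ (vecMulVec u w + vecMulVec u' w') = 0 := by
  have huu : u ≠ u' := fun e => hi.ne (congrArg h e)
  have hadd : u + u' ≠ 0 := by
    intro e
    refine hφ.ne_op_smul hu hu' hi (-1) ?_
    rw [eq_neg_of_add_eq_zero_left e]
    simp
  obtain ⟨c, hc⟩ := h₄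
  have hc0 : c.unop ≠ 0 := by
    intro h0
    rw [MulOpposite.unop_eq_zero_iff] at h0
    exact hφ.col_ne _ hadd (by rw [hc, h0, zero_smul])
  have h5 := hφ.adj_vecMulVec (A := vecMulVec u w + vecMulVec u' w') (u := u + u') (w := w')
    hadd hu (sub_ne_zero.2 hne) (by rw [add_vecMulVec, vecMulVec_sub]; abel)
  rw [hc, ← MulOpposite.op_unop c, op_smul_vecMulVec] at h5
  refine eq_zero_of_rankOne_sub hi hz
    (hφ.adj_vecMulVec (w := w) hu hu' hw' (by abel))
    (hφ.adj_vecMulVec (w := w + w') hu (sub_ne_zero.2 huu.symm) hw'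
      (by rw [sub_vecMulVec, vecMulVec_add]; abel))
    (fun e => hw' (left_eq_add.1 (hφ.injective hu e)))
    (exists_smul_trans (hφ.row _ _ hu hw) h₁) (exists_smul_trans (hφ.row _ _ hu hww) h₃)
    (hφ.adj_vecMulVec (w := w') hu' hu hw (by abel)) (hφ.coeff_ne_zero hu' hw')
    (exists_smul_trans (hφ.row _ _ hu' hw') h₂)
    (hφ.adj_vecMulVec (w := w + w') hu' (sub_ne_zero.2 huu) hw
      (by rw [sub_vecMulVec, vecMulVec_add]; abel)) (hφ.coeff_ne_zero hu' hww)
    (exists_smul_trans (hφ.row _ _ hu' hww) h₃) h5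
    (smul_ne_zero hc0 (hφ.coeff_ne_zero hadd hw'))
    (exists_smul_trans ⟨_, rfl⟩ (exists_smul_trans (hφ.row _ _ hadd hw') h₂))

/-- Either a point of the line through `w` and `w'` is mapped to the line through the images, or a
specific matrix of rank two is mapped into the products with column `h u`. -/
theorem coeff_affine_or_map_eq (hφ : Frame φ h g f) {u u' : ι → D} {w w' : κ → D} (hu : u ≠ 0)
    (hu' : u' ≠ 0)
    (hi : Indep E (f u w) (f u w')) (hh : Indep Eᵐᵒᵖ (h u) (h u')) (s : D) :
    (∃ c : E, f u (s • w + (1 - s) • w') = c • f u w + (1 - c) • f u w') ∨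
      ∃ t, φ (vecMulVec u w' + vecMulVec u' (w - w')) = vecMulVec (h u) t ∧
        (∀ d : D, ∃ c : E, t = c • g (w + d • w')) ∧
        (t ≠ 0 → ∀ d : D, ∃ c : Eᵐᵒᵖ, h (u + MulOpposite.op d • u') = c • h u) := by
  have hind := hφ.indep_of_coeff hu hi
  have hw := hind.left_ne_zero
  have hw' := hind.right_ne_zero
  have hvne : ∀ d : D, w + d • w' ≠ 0 := fun d e =>
    hind.not_smul (-d) (by rw [neg_smul, eq_neg_of_add_eq_zero_left e])
  have hv : w - w' ≠ 0 := by
    have := hvne (-1)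
    rwa [neg_one_smul, ← sub_eq_add_neg] at this
  set C := φ (vecMulVec u w' + vecMulVec u' (w - w')) with hC
  have adj1 : ∀ d : D, RankOne (C - vecMulVec (h u) (f u (w' + d • (w - w')))) := fun d =>
    hφ.adj_vecMulVec hu (a := u' - MulOpposite.op d • u)
      (sub_ne_zero.2 (hφ.ne_op_smul hu' hu hh.symm d)) hv (by
        rw [vecMulVec_add, sub_vecMulVec, op_smul_vecMulVec]; abel)
  have adj2 : ∀ d : D, RankOne (C - vecMulVec (h u') (f u' (w + d • w'))) := fun d =>
    hφ.adj_vecMulVec hu' (a := u - MulOpposite.op (1 + d) • u')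
      (sub_ne_zero.2 (hφ.ne_op_smul hu hu' hh _)) hw' (by
        rw [vecMulVec_add, sub_vecMulVec, op_smul_vecMulVec, vecMulVec_sub, add_smul, one_smul,
          vecMulVec_add]
        abel)
  rcases eq_vecMulVec_or_of_rankOne_sub (hφ.col_ne u hu) (adj1 0) with ⟨t, ht⟩ | ⟨a, b, hb, ha, e⟩
  · right
    have par : ∀ d : D, ∃ c : E, t = c • g (w + d • w') := by
      intro d
      have := adj2 d
      rw [ht] at this
      rcases exists_smul_of_sub (hφ.col_ne u' hu') (hφ.coeff_ne_zero hu' (hvne d)) this with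
        ⟨c, hc⟩ | hc
      · exact absurd hc (hh.not_smul _)
      · exact exists_smul_trans hc (hφ.row _ _ hu' (hvne d))
    refine ⟨t, ht, par, fun ht0 d => ?_⟩
    by_contra! hc
    have hud : u + MulOpposite.op d • u' ≠ 0 := fun e =>
      hφ.ne_op_smul hu hu' hh (-d) (by
        rw [eq_neg_of_add_eq_zero_left e, MulOpposite.op_neg, neg_smul])
    have := hφ.adj_vecMulVec (A := vecMulVec u w' + vecMulVec u' (w - w'))
      (w := w') hud hu' (b := w + (-(1 + d)) • w') (hvne _) (by
        rw [add_vecMulVec, op_smul_vecMulVec, vecMulVec_add, neg_smul, vecMulVec_neg, add_smul,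
          one_smul, vecMulVec_sub, vecMulVec_add]
        abel)
    rw [← hC, ht] at this
    rcases exists_smul_of_sub (hφ.col_ne _ hud) (hφ.coeff_ne_zero hud hw') this with hp | hp
    · obtain ⟨c, hc'⟩ := exists_smul_symm (hφ.col_ne u hu) ⟨_, hp.choose_spec⟩
      exact hc c hc'
    · obtain ⟨k, hk⟩ := exists_smul_trans hp (hφ.row _ _ hud hw')
      obtain ⟨l, hl⟩ := par 0
      rw [zero_smul, add_zero] at hl
      exact ht0 ((hφ.indep_row hu hw hw' hi).eq_zero_of_smul hl hk)
  · left
    have par : ∀ d : D, ∃ c : E, f u w' - f u (w' + d • (w - w')) = c • b := by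
      intro d
      have := adj1 d
      rw [e, zero_smul, add_zero] at this
      exact exists_smul_of_rankOne_sub ha hb this
    have h1 := par 1
    rw [one_smul, add_sub_cancel] at h1
    have h1' := exists_smul_symm (sub_ne_zero.2 fun e => hi.not_smul 1 (by rw [e, one_smul])) h1
    obtain ⟨c, hc⟩ := exists_smul_trans (par s) h1'
    refine ⟨c, ?_⟩
    have : s • w + (1 - s) • w' = w' + s • (w - w') := by
      rw [sub_smul, one_smul, smul_sub]
      abel
    rw [this, ← sub_sub_cancel (f u w') (f u (w' + s • (w - w'))), hc, smul_sub, sub_smul, one_smul]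
    abel

theorem isLineation (hφ : Frame φ h g f) {u : ι → D} (hu : u ≠ 0) : IsLineation D E (f u) := by
  refine ⟨hφ.injective hu, hφ.coeff_zero hu, hφ.coeff_smul hu, ?_⟩
  intro w w' hi s
  by_cases hs : s = 0
  · exact ⟨0, by simp [hs]⟩
  by_cases hs1 : s = 1
  · exact ⟨1, by simp [hs1]⟩
  by_contra hcon
  have hind := hφ.indep_of_coeff hu hi
  have hw := hind.left_ne_zero
  have hw' := hind.right_ne_zero
  have hgi := hφ.indep_row hu hw hw' hi
  have hvne : ∀ a d : D, a ≠ 0 → a • w + d • w' ≠ 0 := fun a d ha e =>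
    ha (hind a (-d) (by rw [neg_smul, eq_neg_of_add_eq_zero_left e])).1
  obtain ⟨u', hu', hh⟩ := hφ.exists_col_indep hu
  obtain ⟨v, hv, hhv, t, ht, hpar, hcol⟩ : ∃ v, v ≠ 0 ∧ Indep Eᵐᵒᵖ (h u) (h v) ∧ ∃ t, t ≠ 0 ∧
      (∀ d : D, ∃ c : E, t = c • g (w + d • w')) ∧
      ∀ d : D, ∃ c : Eᵐᵒᵖ, h (u + MulOpposite.op d • v) = c • h u := by
    obtain ⟨t, ht, hp, hc⟩ := (hφ.coeff_affine_or_map_eq hu hu' hi hh s).resolve_left hcon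
    have hu'' := op_smul_ne_zero hs hu'
    obtain ⟨k, hk0, hk⟩ := hφ.col_smul hu' hs
    have hh' : Indep Eᵐᵒᵖ (h u) (h (MulOpposite.op s • u')) := by
      rw [hk]
      exact hh.smul_right hk0
    obtain ⟨t', ht', hp', hc'⟩ := (hφ.coeff_affine_or_map_eq hu hu'' hi hh' s).resolve_left hcon
    by_cases h0 : t = 0
    · by_cases h0' : t' = 0
      · exfalso
        have := hφ.adj (vecMulVec u w' + vecMulVec u' (w - w'))
          (vecMulVec u w' + vecMulVec (MulOpposite.op s • u') (w - w')) (by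
            rw [add_sub_add_left_eq_sub, op_smul_vecMulVec, ← vecMulVec_sub]
            refine rankOne_vecMulVec hu' ?_
            have := smul_ne_zero (sub_ne_zero.2 (Ne.symm hs1)) (hvne 1 (-1) one_ne_zero)
            rw [neg_one_smul, one_smul, ← sub_eq_add_neg] at this
            rwa [sub_smul, one_smul] at this)
        rw [ht, ht', h0, h0', sub_self] at this
        exact not_rankOne_zero this
      · exact ⟨_, hu'', hh', t', h0', hp', hc' h0'⟩
    · exact ⟨_, hu', hh, t, h0, hp, hc h0⟩
  have hgpar : ∀ d : D, ∃ c : E, g (w + d • w') = c • g w := by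
    intro d
    have := hpar 0
    rw [zero_smul, add_zero] at this
    exact exists_smul_trans (exists_smul_symm ht (hpar d)) this
  have hc1 := hcol 1
  rw [MulOpposite.op_one, one_smul] at hc1
  have z1 := hφ.map_eq_zero hu hv hw hw' (by simpa using hvne 1 1 one_ne_zero)
    (fun e => hind.not_smul 1 (by rw [e, one_smul])) hhv hgi ⟨1, (one_smul _ _).symm⟩
    ⟨1, (one_smul _ _).symm⟩ (by simpa using hgpar 1) hc1
  have hsw : s • (w + s⁻¹ • w') = s • w + w' := by
    rw [smul_add, smul_smul, mul_inv_cancel₀ hs, one_smul]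
  have z2 := hφ.map_eq_zero hu hv (smul_ne_zero hs hw) hw' (by simpa using hvne s 1 hs)
    (fun e => hind.not_smul s⁻¹ (by rw [← e, smul_smul, inv_mul_cancel₀ hs, one_smul])) hhv hgi
    (hφ.row_smul hw hs) ⟨1, (one_smul _ _).symm⟩
    (by
      rw [← hsw]
      exact exists_smul_trans (hφ.row_smul (by simpa using hvne 1 s⁻¹ one_ne_zero) hs)
        (hgpar s⁻¹)) hc1
  have := hφ.adj (vecMulVec u w + vecMulVec v w') (vecMulVec u (s • w) + vecMulVec v w') (by
    rw [add_sub_add_right_eq_sub, ← vecMulVec_sub]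
    refine rankOne_vecMulVec hu ?_
    have := smul_ne_zero (sub_ne_zero.2 (Ne.symm hs1)) hw
    rwa [sub_smul, one_smul] at this)
  rw [z1, z2, sub_self] at this
  exact not_rankOne_zero this

end Frame

end Frame

section TwoElements

variable {K M : Type*} [DivisionRing K] [AddCommGroup M] [Module K M]

theorem indep_of_two_elements (hK : ∀ c : K, c = 0 ∨ c = 1) {a b : M} (ha : a ≠ 0) (hb : b ≠ 0)
    (hab : a ≠ b) : Indep K a b := by
  intro s t e
  rcases hK s with rfl | rfl <;> rcases hK t with rfl | rfl <;> simp_all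

theorem eq_of_two_elements (hK : ∀ c : K, c = 0 ∨ c = 1) {a b : M} (ha : a ≠ 0)
    (h : ∃ c : K, a = c • b) : a = b := by
  obtain ⟨c, rfl⟩ := h
  rcases hK c with rfl | rfl <;> simp_all

theorem add_self_of_two_elements (hK : ∀ c : K, c = 0 ∨ c = 1) (a : M) : a + a = 0 := by
  have : (1 + 1 : K) = 0 := (hK (1 + 1)).resolve_right (by simp)
  rw [← one_smul K a, ← add_smul, this, zero_smul]

end TwoElements

namespace Frame

variable {E ι κ ι' κ' : Type*} [DivisionRing E] {φ : Matrix ι κ D → Matrix ι' κ' E}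
  {h : (ι → D) → ι' → E} {g : (κ → D) → κ' → E} {f : (ι → D) → (κ → D) → κ' → E}

theorem eq_row (hφ : Frame φ h g f) (hE : ∀ c : E, c = 0 ∨ c = 1) {u : ι → D} {w : κ → D}
    (hu : u ≠ 0) (hw : w ≠ 0) : f u w = g w :=
  eq_of_two_elements hE (hφ.coeff_ne_zero hu hw) (hφ.row u w hu hw)

theorem col_ne_col (hφ : Frame φ h g f) (hE : ∀ c : E, c = 0 ∨ c = 1) {u u' : ι → D}
    (hu : u ≠ 0) (hu' : u' ≠ 0) (hne : u ≠ u') : h u ≠ h u' := by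
  intro e
  obtain ⟨w, -, hw, -⟩ := hφ.exists_row
  have := hφ.adj (vecMulVec u w) (vecMulVec u' w) (by
    rw [← sub_vecMulVec]
    exact rankOne_vecMulVec (sub_ne_zero.2 hne) hw)
  rw [hφ.col _ _ hu, hφ.col _ _ hu', hφ.eq_row hE hu hw, hφ.eq_row hE hu' hw, e, sub_self] at this
  exact not_rankOne_zero this

theorem map_add_of_two_elements (hφ : Frame φ h g f) (hE : ∀ c : E, c = 0 ∨ c = 1)
    {u u' : ι → D} {w w' : κ → D} (hu : u ≠ 0) (hu' : u' ≠ 0) (hw : w ≠ 0) (hw' : w' ≠ 0)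
    (hww : w + w' ≠ 0) (hne : w ≠ w') (hh : Indep Eᵐᵒᵖ (h u) (h u')) :
    φ (vecMulVec u w + vecMulVec u' w') = 0 ∨
      φ (vecMulVec u w + vecMulVec u' w') =
        vecMulVec (h u) (g w) + vecMulVec (h u - h (u + u')) (g w - g (w + w')) := by
  have hE' : ∀ c : Eᵐᵒᵖ, c = 0 ∨ c = 1 := fun c => by simpa using hE c.unop
  have huu : u + u' ≠ 0 := fun e => hφ.ne_op_smul hu hu' hh (-1) (by
    rw [eq_neg_of_add_eq_zero_left e]
    simp)
  have gne : ∀ {a b : κ → D}, a ≠ 0 → b ≠ 0 → a ≠ b → g a ≠ g b := by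
    intro a b ha hb hab e
    rw [← hφ.eq_row hE hu ha, ← hφ.eq_row hE hu hb] at e
    exact hab (hφ.injective hu e)
  have a1 := hφ.adj_vecMulVec (A := vecMulVec u w + vecMulVec u' w') (w := w) hu hu' hw' (by abel)
  have a2 := hφ.adj_vecMulVec (A := vecMulVec u w + vecMulVec u' w') (w := w') hu' hu hw (by abel)
  have a3 := hφ.adj_vecMulVec (A := vecMulVec u w + vecMulVec u' w') (w := w + w') hu
    (sub_ne_zero.2 fun e => hh.ne (congrArg h e.symm)) hw'
    (by rw [sub_vecMulVec, vecMulVec_add]; abel)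
  have a4 := hφ.adj_vecMulVec (A := vecMulVec u w + vecMulVec u' w') (w := w) huu hu'
    (sub_ne_zero.2 hne.symm) (by rw [add_vecMulVec, vecMulVec_sub]; abel)
  rw [hφ.eq_row hE hu hw] at a1
  rw [hφ.eq_row hE hu' hw'] at a2
  rw [hφ.eq_row hE hu hww] at a3
  rw [hφ.eq_row hE huu hw] at a4
  have hcol : Indep Eᵐᵒᵖ (h u) (h (u + u')) := indep_of_two_elements hE' (hφ.col_ne u hu)
    (hφ.col_ne _ huu) (hφ.col_ne_col hE hu huu (by simpa using hu'))
  have hg13 : g w ≠ g (w + w') := gne hw hww (by simpa using hw')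
  rcases eq_vecMulVec_or_of_rankOne_sub (hφ.col_ne u hu) a1 with ⟨t, ht⟩ | ⟨s, t, ht, hs, e⟩
  · left
    rw [ht] at a2 a4 ⊢
    obtain ⟨c, hc⟩ := (exists_smul_of_sub (hφ.col_ne _ hu') (hφ.row_ne _ hw') a2).resolve_left
      fun hc => hh.not_smul _ hc.choose_spec
    obtain ⟨c', hc'⟩ := (exists_smul_of_sub (hφ.col_ne _ huu) (hφ.row_ne _ hw) a4).resolve_left
      fun hc => hcol.not_smul _ hc.choose_spec
    rw [(indep_of_two_elements hE (hφ.row_ne w hw) (hφ.row_ne w' hw')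
      (gne hw hw' hne)).eq_zero_of_smul hc' hc, vecMulVec_zero_right]
  · right
    rw [e] at a3 a4 ⊢
    have ht' := eq_of_two_elements hE (sub_ne_zero.2 hg13) (exists_smul_of_rankOne_sub hs ht a3)
    rw [← ht'] at a4 ⊢
    congr 2
    have hs' : s ≠ 0 := hs.left_ne_zero
    rw [add_sub_right_comm, ← sub_vecMulVec] at a4
    obtain hc | hc := exists_smul_of_add hs' (sub_ne_zero.2 hg13) a4
    · exact (eq_of_two_elements hE' (sub_ne_zero.2 hcol.ne)
        ⟨_, hc.choose_spec⟩).symm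
    · have := eq_of_two_elements hE (hφ.row_ne w hw) hc
      rw [eq_comm, sub_eq_self] at this
      exact absurd this (hφ.row_ne _ hww)

theorem coeff_add_of_two_elements (hφ : Frame φ h g f) (hD : ∀ c : D, c = 0 ∨ c = 1)
    (hE : ∀ c : E, c = 0 ∨ c = 1) {u : ι → D} {w w' : κ → D} (hu : u ≠ 0)
    (hi : Indep E (f u w) (f u w')) : f u (w + w') = f u w + f u w' := by
  have hE' : ∀ c : Eᵐᵒᵖ, c = 0 ∨ c = 1 := fun c => by simpa using hE c.unop
  have hind := hφ.indep_of_coeff hu hi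
  have hw := hind.left_ne_zero
  have hw' := hind.right_ne_zero
  have hww : w + w' ≠ 0 := fun e => hind.not_smul (-1) (by
    rw [neg_one_smul, eq_neg_of_add_eq_zero_left e])
  obtain ⟨u', hu', hh⟩ := hφ.exists_col_indep hu
  have huu : u + u' ≠ 0 := fun e => hφ.ne_op_smul hu hu' hh (-1) (by
    rw [eq_neg_of_add_eq_zero_left e]
    simp)
  have gne : ∀ {a b : κ → D}, a ≠ 0 → b ≠ 0 → a ≠ b → g a ≠ g b := by
    intro a b ha hb hab e
    rw [← hφ.eq_row hE hu ha, ← hφ.eq_row hE hu hb] at e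
    exact hab (hφ.injective hu e)
  have hw2 : w + w' + w' = w := by rw [add_assoc, add_self_of_two_elements hD, add_zero]
  have hne0 : φ (vecMulVec u w + vecMulVec u' w') ≠ 0 := by
    intro h0
    have hr := hφ.adj (vecMulVec u (w + w') + vecMulVec u' w')
      (vecMulVec u w + vecMulVec u' w') (by
        rw [add_sub_add_right_eq_sub, ← vecMulVec_sub, add_sub_cancel_left]
        exact rankOne_vecMulVec hu hw')
    rw [h0, sub_zero] at hr
    rcases hφ.map_add_of_two_elements hE hu hu' hww hw' (by rwa [hw2]) (by simpa using hw) hh with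
      e | e
    · rw [e] at hr
      exact not_rankOne_zero hr
    · rw [e, hw2] at hr
      have h13 := hφ.col_ne_col hE hu huu (by simpa using hu')
      have g13 : g (w + w') ≠ g w := gne hww hw (by simpa using hw')
      refine not_rankOne_add (indep_of_two_elements hE' (hφ.col_ne u hu) (sub_ne_zero.2 h13) ?_)
        (indep_of_two_elements hE (hφ.row_ne _ hww) (sub_ne_zero.2 g13) ?_) hr
      · intro e
        rw [eq_comm, sub_eq_self] at e
        exact hφ.col_ne _ huu e
      · intro e
        rw [eq_comm, sub_eq_self] at e
        exact hφ.row_ne _ hw e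
  have e1 := (hφ.map_add_of_two_elements hE hu hu' hw hw' hww hind.ne hh).resolve_left hne0
  rw [add_comm] at hne0
  have e2 := (hφ.map_add_of_two_elements hE hu' hu hw' hw (by rwa [add_comm]) hind.ne.symm
    hh.symm).resolve_left hne0
  rw [add_comm (vecMulVec u' w'), e1, add_comm w', add_comm u'] at e2
  have key : vecMulVec (h u - h u') (g (w + w')) = vecMulVec (h (u + u')) (g w' - g w) := by
    have d1 : vecMulVec (h u) (g w) + vecMulVec (h u) (g w) = 0 := by
      rw [← vecMulVec_add, add_self_of_two_elements hE, vecMulVec_zero_right]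
    have d2 : vecMulVec (h u') (g w') + vecMulVec (h u') (g w') = 0 := by
      rw [← vecMulVec_add, add_self_of_two_elements hE, vecMulVec_zero_right]
    simp only [sub_vecMulVec, vecMulVec_sub] at e2 ⊢
    rw [← sub_eq_zero] at e2 ⊢
    rw [← neg_eq_zero, ← e2, ← sub_eq_zero, ← sub_zero (0 : Matrix ι' κ' E)]
    nth_rewrite 1 [← d2]
    rw [← d1]
    abel
  obtain ⟨c, hc0, -, hc⟩ := exists_smul_of_vecMulVec_eq (sub_ne_zero.2 hh.ne) (hφ.row_ne _ hww) key
  rw [hφ.eq_row hE hu hw, hφ.eq_row hE hu hw', hφ.eq_row hE hu hww,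
    eq_of_two_elements hE (hφ.row_ne _ hww) ⟨c, hc⟩, sub_eq_add_neg, add_comm,
    neg_eq_of_add_eq_zero_left (add_self_of_two_elements hE (g w))]

/-- The row coefficients over a fixed column depend semilinearly on the row. -/
theorem exists_ringEquiv (hφ : Frame φ h g f) (hsurj : ∀ τ : D →+* E, Function.Surjective τ)
    (e : D ≃ E) {u : ι → D} (hu : u ≠ 0) :
    ∃ τ : D ≃+* E, (∀ w w', f u (w + w') = f u w + f u w') ∧
      ∀ (d : D) (w : κ → D), f u (d • w) = τ d • f u w := by
  have hl := hφ.isLineation hu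
  have hother : ∀ {w : κ → D}, w ≠ 0 → ∃ w', Indep E (f u w) (f u w') := by
    intro w hw
    obtain ⟨w', hw', hi⟩ := hφ.exists_row_indep hw
    exact ⟨w', hφ.indep_coeff hu hw hw' hi⟩
  have hind : ∃ w w', Indep E (f u w) (f u w') := by
    obtain ⟨w, -, hw, -⟩ := hφ.exists_row
    exact ⟨w, hother hw⟩
  suffices (∀ (w : κ → D) (c : E), w ≠ 0 → ∃ d : D, f u (d • w) = c • f u w) ∧
      ∀ w w', Indep E (f u w) (f u w') → f u (w + w') = f u w + f u w' by
    refine exists_ringEquiv_of_add hl.injective hl.map_zero hl.map_smul (fun w c => ?_) this.2 hind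
    by_cases hw : w = 0
    · exact ⟨0, by rw [hw, smul_zero, hl.map_zero, smul_zero]⟩
    · exact this.1 w c hw
  rcases finite_or_infinite D with hD | hD
  · constructor
    · intro w c hw
      choose σ hσ using fun d : D => hl.map_smul d w
      obtain ⟨d, hd⟩ := (Finite.injective_iff_surjective_of_equiv e).1 (fun a b hab =>
        smul_left_injective D hw (hl.injective (by simp only [hσ, hab])) : Function.Injective σ) c
      exact ⟨d, by rw [hσ, hd]⟩
    · intro w w' hi
      by_cases ht : ∃ t : D, t ≠ 0 ∧ t ≠ 1
      · exact hl.add_of_finite e ht hi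
      · push Not at ht
        have hD2 : ∀ c : D, c = 0 ∨ c = 1 := fun c => or_iff_not_imp_left.2 (ht c)
        refine hφ.coeff_add_of_two_elements hD2 (fun c => ?_) hu hi
        by_contra! hc
        have h1 := e.symm.injective.ne hc.1
        have h2 := e.symm.injective.ne hc.2
        have h3 := e.symm.injective.ne (zero_ne_one (α := E))
        rcases hD2 (e.symm c) with a | a <;> rcases hD2 (e.symm 0) with b | b <;>
          rcases hD2 (e.symm 1) with d | d <;> simp_all
  · constructor
    · intro w c hw
      obtain ⟨w', hi⟩ := hother hw
      exact (hl.add_of_infinite hsurj hi).2 c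
    · exact fun w w' hi => (hl.add_of_infinite hsurj hi).1

end Frame

theorem exists_smul_eq_of_add {K M V : Type*} [DivisionRing K] [AddCommGroup M] [Module K M]
    [AddCommGroup V] {A B : V → M} (hA : ∀ v w, A (v + w) = A v + A w)
    (hB : ∀ v w, B (v + w) = B v + B w) (hAB : ∀ v, ∃ c : K, A v = c • B v)
    (hi : ∃ v w, Indep K (B v) (B w)) : ∃ c : K, ∀ v, A v = c • B v := by
  choose c hc using hAB
  have heq : ∀ v w, Indep K (B v) (B w) → c v = c w := by
    intro v w h
    have := hc (v + w)
    rw [hA, hB, smul_add, hc, hc] at this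
    obtain ⟨h1, h2⟩ := h.coeff_eq this
    rw [h1, h2]
  obtain ⟨v₁, v₂, h₁₂⟩ := hi
  refine ⟨c v₁, fun v => ?_⟩
  by_cases hv : B v = 0
  · rw [hc, hv, smul_zero, smul_zero]
  rcases exists_indep_of_indep h₁₂ hv with h | h
  · rw [hc, heq _ _ h]
  · rw [hc, heq _ _ h, heq _ _ h₁₂]

theorem vecMulVec_add_eq_iff {ι κ : Type*} {a a' b b' : ι → D} {p q : κ → D} (h : Indep D p q)
    (e : vecMulVec a p + vecMulVec b q = vecMulVec a' p + vecMulVec b' q) : a = a' ∧ b = b' := by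
  have e' : vecMulVec (a - a') p = vecMulVec (b' - b) q := by
    rw [sub_vecMulVec, sub_vecMulVec, sub_eq_sub_iff_add_eq_add, e, add_comm]
  have ha : a = a' := by
    by_contra hne
    obtain ⟨c, -, -, hc⟩ := exists_smul_of_vecMulVec_eq (sub_ne_zero.2 hne) h.left_ne_zero e'
    exact h.not_smul c hc
  exact ⟨ha, vecMulVec_right_cancel h.right_ne_zero (add_left_cancel (ha ▸ e))⟩

theorem eq_zero_or_eq_add_of_rankOne {ι κ : Type*} {a b s : ι → D} {p q : κ → D}
    {C : Matrix ι κ D} (hab : Indep Dᵐᵒᵖ a b) (hpq : Indep D p q) (has : a ≠ s)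
    (h₁ : RankOne (C - vecMulVec a p)) (h₂ : RankOne (C - vecMulVec a (p + q)))
    (h₃ : RankOne (C - vecMulVec s p)) (h₄ : RankOne (C - vecMulVec b q))
    (h₅ : RankOne (C - vecMulVec b (p + q))) :
    C = 0 ∨ ∃ e, Indep Dᵐᵒᵖ e a ∧ (∃ k : Dᵐᵒᵖ, e = k • (s - a)) ∧
      C = vecMulVec a p + vecMulVec e q := by
  have hpq' : Indep D q (p + q) := by simpa using hpq.symm.add_right 1
  rcases eq_vecMulVec_or_of_rankOne_sub hab.left_ne_zero h₁ with ⟨t, rfl⟩ | ⟨e, t, ht, he, rfl⟩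
  · left
    have par : ∀ y, y ≠ 0 → RankOne (vecMulVec a t - vecMulVec b y) → ∃ c : D, t = c • y :=
      fun y hy hr => (exists_smul_of_sub hab.right_ne_zero hy hr).resolve_left
        fun hc => hab.not_smul _ hc.choose_spec
    obtain ⟨k, hk⟩ := par q hpq'.left_ne_zero h₄
    obtain ⟨l, hl⟩ := par _ hpq'.right_ne_zero h₅
    rw [hpq'.eq_zero_of_smul hk hl, vecMulVec_zero_right]
  · right
    obtain ⟨c, hc⟩ := exists_smul_of_rankOne_sub he ht h₂
    rw [sub_add_cancel_left, neg_eq_iff_eq_neg, ← neg_smul] at hc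
    obtain ⟨k, rfl⟩ := exists_smul_symm hpq.right_ne_zero ⟨_, hc⟩
    have hk : k ≠ 0 := by
      rintro rfl
      exact ht (zero_smul _ _)
    rw [← op_smul_vecMulVec] at h₃ ⊢
    have he' := he.smul_left (c := MulOpposite.op k) (by simpa using hk)
    refine ⟨_, he', ?_, rfl⟩
    rw [add_sub_right_comm, ← sub_vecMulVec] at h₃
    obtain ⟨l, hl⟩ := (exists_smul_of_add he'.left_ne_zero hpq.right_ne_zero h₃).resolve_right
      fun hc => hpq.not_smul _ hc.choose_spec
    obtain ⟨l', hl'⟩ := exists_smul_symm (sub_ne_zero.2 has) ⟨_, hl⟩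
    exact ⟨-l', by rw [hl', neg_smul, ← smul_neg, neg_sub]⟩

/-- A map preserving adjacency and acting on products of columns and rows by `x` and by the
semilinear map `F`. -/
structure ProductForm {E ι κ ι' κ' : Type*} [DivisionRing E] (φ : Matrix ι κ D → Matrix ι' κ' E)
    (τ : D ≃+* E) (x : (ι → D) → ι' → E) (F : (κ → D) → κ' → E) : Prop where
  adj : ∀ A B, RankOne (A - B) → RankOne (φ A - φ B)
  map_vecMulVec : ∀ u w, φ (vecMulVec u w) = vecMulVec (x u) (F w)
  row_add : ∀ w w', F (w + w') = F w + F w'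
  row_smul : ∀ d w, F (d • w) = τ d • F w
  row_ne : ∀ w, w ≠ 0 → F w ≠ 0
  exists_row : ∃ w w', Indep E (F w) (F w')

theorem Frame.exists_productForm {E ι κ ι' κ' : Type*} [DivisionRing E]
    {φ : Matrix ι κ D → Matrix ι' κ' E} {h : (ι → D) → ι' → E} {g : (κ → D) → κ' → E}
    {f : (ι → D) → (κ → D) → κ' → E} (hφ : Frame φ h g f)
    (hsurj : ∀ τ : D →+* E, Function.Surjective τ) (e : D ≃ E) :
    ∃ τ x F, ProductForm φ τ x F := by
  classical
  obtain ⟨u₀, -, hu₀, -⟩ := hφ.exists_col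
  obtain ⟨τ, hadd, hsmul⟩ := hφ.exists_ringEquiv hsurj e hu₀
  have hrow : ∃ w w', Indep E (f u₀ w) (f u₀ w') := by
    obtain ⟨w, w', hw, hw', hi⟩ := hφ.exists_row
    exact ⟨w, w', hφ.indep_coeff hu₀ hw hw' hi⟩
  have hk : ∀ u, ∃ k : E, u ≠ 0 → ∀ w, f u w = k • f u₀ w := by
    intro u
    by_cases hu : u = 0
    · exact ⟨0, fun h => absurd hu h⟩
    obtain ⟨τ', hadd', -⟩ := hφ.exists_ringEquiv hsurj e hu
    obtain ⟨k, hk⟩ := exists_smul_eq_of_add (K := E) hadd' hadd (fun w => by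
      by_cases hw : w = 0
      · exact ⟨0, by rw [hw, hφ.coeff_zero hu, zero_smul]⟩
      · exact exists_smul_trans (hφ.row _ _ hu hw) (hφ.row' hu₀ hw)) hrow
    exact ⟨k, fun _ => hk⟩
  choose k hk using hk
  refine ⟨τ, fun u => if u = 0 then 0 else MulOpposite.op (k u) • h u, f u₀, hφ.adj, fun u w => ?_,
    hadd, hsmul, fun w => hφ.coeff_ne_zero hu₀, hrow⟩
  by_cases hu : u = 0
  · simp [hu, hφ.zero]
  · rw [if_neg hu, op_smul_vecMulVec, ← hk u hu, hφ.col _ _ hu]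

namespace ProductForm

variable {E ι κ ι' κ' : Type*} [DivisionRing E] {φ : Matrix ι κ D → Matrix ι' κ' E} {τ : D ≃+* E}
  {x : (ι → D) → ι' → E} {F : (κ → D) → κ' → E}

theorem row_injective (hφ : ProductForm φ τ x F) : Function.Injective F := by
  intro a b e
  by_contra hne
  refine hφ.row_ne _ (sub_ne_zero.2 hne) ?_
  have := hφ.row_add (a - b) b
  rwa [sub_add_cancel, e, right_eq_add] at this

theorem exists_row_ne (hφ : ProductForm φ τ x F) : ∃ w, w ≠ 0 ∧ F w ≠ 0 := by
  obtain ⟨w, w', hi⟩ := hφ.exists_row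
  refine ⟨w, ?_, hi.left_ne_zero⟩
  rintro rfl
  have := hφ.row_add 0 0
  rw [zero_add, right_eq_add] at this
  exact hi.left_ne_zero this

theorem row_indep (hφ : ProductForm φ τ x F) {w w' : κ → D} (h : Indep D w w') :
    Indep E (F w) (F w') := by
  intro s t e
  obtain ⟨s, rfl⟩ := τ.surjective s
  obtain ⟨t, rfl⟩ := τ.surjective t
  rw [← hφ.row_smul, ← hφ.row_smul] at e
  obtain ⟨rfl, rfl⟩ := h _ _ (hφ.row_injective e)
  simp

theorem exists_indep (hφ : ProductForm φ τ x F) : ∃ w w' : κ → D, Indep D w w' := by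
  obtain ⟨w, w', hi⟩ := hφ.exists_row
  refine ⟨w, w', fun s t e => ?_⟩
  have := hi (τ s) (τ t) (by rw [← hφ.row_smul, ← hφ.row_smul, e])
  simpa using this

theorem row_zero (hφ : ProductForm φ τ x F) : F 0 = 0 := by
  have := hφ.row_add 0 0
  rwa [zero_add, right_eq_add] at this

theorem col_injective (hφ : ProductForm φ τ x F) : Function.Injective x := by
  intro a b e
  by_contra hne
  obtain ⟨w, hw, -⟩ := hφ.exists_row_ne
  have := hφ.adj (vecMulVec a w) (vecMulVec b w) (by
    rw [← sub_vecMulVec]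
    exact rankOne_vecMulVec (sub_ne_zero.2 hne) hw)
  rw [hφ.map_vecMulVec, hφ.map_vecMulVec, e, sub_self] at this
  exact not_rankOne_zero this

theorem col_smul (hφ : ProductForm φ τ x F) (d : D) (u : ι → D) :
    x (MulOpposite.op d • u) = MulOpposite.op (τ d) • x u := by
  obtain ⟨w, -, hw⟩ := hφ.exists_row_ne
  refine vecMulVec_right_cancel hw ?_
  rw [op_smul_vecMulVec, ← hφ.row_smul, ← hφ.map_vecMulVec, ← hφ.map_vecMulVec, op_smul_vecMulVec]

theorem col_zero (hφ : ProductForm φ τ x F) : x 0 = 0 := by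
  have := hφ.col_smul 0 0
  rwa [smul_zero, _root_.map_zero, MulOpposite.op_zero, zero_smul] at this

theorem col_indep (hφ : ProductForm φ τ x F) {u u' : ι → D} (h : Indep Dᵐᵒᵖ u u') :
    Indep Eᵐᵒᵖ (x u) (x u') := by
  intro s t e
  obtain ⟨s', hs⟩ := τ.surjective s.unop
  obtain ⟨t', ht⟩ := τ.surjective t.unop
  rw [← MulOpposite.op_unop s, ← MulOpposite.op_unop t, ← hs, ← ht, ← hφ.col_smul,
    ← hφ.col_smul] at e
  obtain ⟨h1, h2⟩ := h _ _ (hφ.col_injective e)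
  rw [MulOpposite.op_eq_zero_iff] at h1 h2
  rw [h1, _root_.map_zero, eq_comm, MulOpposite.unop_eq_zero_iff] at hs
  rw [h2, _root_.map_zero, eq_comm, MulOpposite.unop_eq_zero_iff] at ht
  exact ⟨hs, ht⟩

theorem eq_zero_or_eq_add (hφ : ProductForm φ τ x F) {u u' : ι → D} {w w' : κ → D}
    (hu : Indep Dᵐᵒᵖ u u') (hw : Indep D w w') :
    φ (vecMulVec u w + vecMulVec u' w') = 0 ∨
      ∃ e, Indep Eᵐᵒᵖ e (x u) ∧ (∃ k : Eᵐᵒᵖ, e = k • (x (u + u') - x u)) ∧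
        φ (vecMulVec u w + vecMulVec u' w') = vecMulVec (x u) (F w) + vecMulVec e (F w') := by
  have adj : ∀ (v a : ι → D) (y b : κ → D), a ≠ 0 → b ≠ 0 →
      vecMulVec u w + vecMulVec u' w' - vecMulVec v y = vecMulVec a b →
      RankOne (φ (vecMulVec u w + vecMulVec u' w') - vecMulVec (x v) (F y)) := by
    intro v a y b ha hb e
    rw [← hφ.map_vecMulVec]
    exact hφ.adj _ _ (e ▸ rankOne_vecMulVec ha hb)
  have h₂ := adj u (u' - u) (w + w') w' (sub_ne_zero.2 hu.ne.symm) hw.right_ne_zero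
    (by rw [sub_vecMulVec, vecMulVec_add]; abel)
  have h₅ := adj u' (u - u') (w + w') w (sub_ne_zero.2 hu.ne) hw.left_ne_zero
    (by rw [sub_vecMulVec, vecMulVec_add]; abel)
  rw [hφ.row_add] at h₂ h₅
  exact eq_zero_or_eq_add_of_rankOne (hφ.col_indep hu) (hφ.row_indep hw)
    (fun e => hu.right_ne_zero (left_eq_add.1 (hφ.col_injective e)))
    (adj u u' w w' hu.right_ne_zero hw.right_ne_zero (by abel)) h₂
    (adj (u + u') u' w (w' - w) hu.right_ne_zero (sub_ne_zero.2 hw.ne.symm)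
      (by rw [add_vecMulVec, vecMulVec_sub]; abel))
    (adj u' u w' w hu.left_ne_zero hw.left_ne_zero (by abel)) h₅

theorem map_ne_zero (hφ : ProductForm φ τ x F) {u u' : ι → D} {w w' : κ → D}
    (hu : Indep Dᵐᵒᵖ u u') (hw : Indep D w w') : φ (vecMulVec u w + vecMulVec u' w') ≠ 0 := by
  intro h0
  have hw' : Indep D w (w' + w) := by simpa using hw.add_right 1
  have hr := hφ.adj (vecMulVec u w + vecMulVec u' (w' + w))
    (vecMulVec u w + vecMulVec u' w') (by
      rw [add_sub_add_left_eq_sub, ← vecMulVec_sub, add_sub_cancel_left]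
      exact rankOne_vecMulVec hu.right_ne_zero hw.left_ne_zero)
  rw [h0, sub_zero] at hr
  rcases hφ.eq_zero_or_eq_add hu hw' with e | ⟨e, he, -, e'⟩
  · rw [e] at hr
    exact not_rankOne_zero hr
  · rw [e'] at hr
    exact not_rankOne_add he.symm (hφ.row_indep hw') hr

theorem col_add_and_map_add (hφ : ProductForm φ τ x F) {u u' : ι → D} {w w' : κ → D}
    (hu : Indep Dᵐᵒᵖ u u') (hw : Indep D w w') :
    x (u + u') = x u + x u' ∧
      φ (vecMulVec u w + vecMulVec u' w') =
        vecMulVec (x u) (F w) + vecMulVec (x u') (F w') := by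
  have hne := hφ.map_ne_zero hu hw
  obtain ⟨e, -, ⟨k, hk⟩, he⟩ := (hφ.eq_zero_or_eq_add hu hw).resolve_left hne
  rw [add_comm] at hne
  obtain ⟨e', -, ⟨l, hl⟩, he'⟩ := (hφ.eq_zero_or_eq_add hu.symm hw.symm).resolve_left hne
  rw [add_comm, he, add_comm] at he'
  rw [add_comm u'] at hl
  obtain ⟨rfl, rfl⟩ := vecMulVec_add_eq_iff (hφ.row_indep hw.symm) he'
  refine ⟨?_, he⟩
  have hi := hφ.col_indep hu
  obtain ⟨k', hk'⟩ := exists_smul_symm hi.right_ne_zero ⟨k, hk⟩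
  obtain ⟨l', hl'⟩ := exists_smul_symm hi.left_ne_zero ⟨l, hl⟩
  rw [sub_eq_iff_eq_add] at hk' hl'
  have := hi.coeff_eq (s := 1) (t := k') (s' := l') (t' := 1) (by
    rw [one_smul, one_smul, ← hl', hk', add_comm])
  rw [hk', this.2, one_smul, add_comm]

theorem col_add (hφ : ProductForm φ τ x F) (u u' : ι → D) : x (u + u') = x u + x u' := by
  by_cases hu : Indep Dᵐᵒᵖ u u'
  · obtain ⟨w, w', hw⟩ := hφ.exists_indep
    exact (hφ.col_add_and_map_add hu hw).1
  by_cases hu' : u' = 0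
  · rw [hu', hφ.col_zero, add_zero, add_zero]
  obtain ⟨c, rfl⟩ := exists_smul_of_not_indep hu hu'
  obtain ⟨c, rfl⟩ := MulOpposite.op_surjective c
  have : MulOpposite.op c • u' + u' = MulOpposite.op (c + 1) • u' := by
    rw [MulOpposite.op_add, add_smul, MulOpposite.op_one, one_smul]
  rw [this, hφ.col_smul, hφ.col_smul, map_add, map_one, MulOpposite.op_add, add_smul,
    MulOpposite.op_one, one_smul]

theorem map_add_vecMulVec (hφ : ProductForm φ τ x F) (u u' : ι → D) (w w' : κ → D) :
    φ (vecMulVec u w + vecMulVec u' w') =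
      vecMulVec (x u) (F w) + vecMulVec (x u') (F w') := by
  by_cases hu' : u' = 0
  · simp [hu', hφ.col_zero, hφ.map_vecMulVec]
  by_cases hw' : w' = 0
  · simp [hw', hφ.row_zero, hφ.map_vecMulVec, vecMulVec_zero_right]
  by_cases hu : Indep Dᵐᵒᵖ u u'
  · by_cases hw : Indep D w w'
    · exact (hφ.col_add_and_map_add hu hw).2
    · obtain ⟨c, rfl⟩ := exists_smul_of_not_indep hw hw'
      rw [← op_smul_vecMulVec, ← add_vecMulVec, hφ.map_vecMulVec, hφ.col_add, hφ.col_smul,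
        hφ.row_smul, add_vecMulVec, op_smul_vecMulVec]
  · obtain ⟨c, rfl⟩ := exists_smul_of_not_indep hu hu'
    obtain ⟨c, rfl⟩ := MulOpposite.op_surjective c
    rw [op_smul_vecMulVec, ← vecMulVec_add, hφ.map_vecMulVec, hφ.row_add, hφ.row_smul, hφ.col_smul,
      vecMulVec_add, op_smul_vecMulVec]

/-- The matrix expression agreeing with `φ` on products. -/
noncomputable def linearization [Fintype ι] [Fintype κ] [DecidableEq ι] [DecidableEq κ]
    (τ : D ≃+* E) (x : (ι → D) → ι' → E) (F : (κ → D) → κ' → E) (M : Matrix ι κ D) :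
    Matrix ι' κ' E :=
  (Matrix.of fun i' i => x (Pi.single i 1) i') * M.map τ *
    (Matrix.of fun j j' => F (Pi.single j 1) j')

theorem mulVec_eq [Fintype ι] [DecidableEq ι] (hφ : ProductForm φ τ x F) (u : ι → D) :
    (Matrix.of fun i' i => x (Pi.single i 1) i') *ᵥ (fun i => τ (u i)) = x u := by
  let X : (ι → D) →+ (ι' → E) := ⟨⟨x, hφ.col_zero⟩, hφ.col_add⟩
  have hu : u = ∑ i, MulOpposite.op (u i) • (Pi.single i 1 : ι → D) := by
    ext j
    simp [Finset.sum_apply, Pi.single_apply]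
  have h : x u = ∑ i, MulOpposite.op (τ (u i)) • x (Pi.single i 1) := by
    change X u = _
    conv_lhs => rw [hu]
    rw [map_sum]
    exact Finset.sum_congr rfl fun i _ => hφ.col_smul _ _
  rw [h]
  ext i'
  simp [mulVec, dotProduct, Finset.sum_apply]

theorem vecMul_eq [Fintype κ] [DecidableEq κ] (hφ : ProductForm φ τ x F) (w : κ → D) :
    (fun j => τ (w j)) ᵥ* (Matrix.of fun j j' => F (Pi.single j 1) j') = F w := by
  let G : (κ → D) →+ (κ' → E) := ⟨⟨F, hφ.row_zero⟩, hφ.row_add⟩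
  have hw : w = ∑ j, w j • (Pi.single j 1 : κ → D) := by
    ext j
    simp [Finset.sum_apply, Pi.single_apply]
  have h : F w = ∑ j, τ (w j) • F (Pi.single j 1) := by
    change G w = _
    conv_lhs => rw [hw]
    rw [map_sum]
    exact Finset.sum_congr rfl fun j _ => hφ.row_smul _ _
  rw [h]
  ext j'
  simp [vecMul, dotProduct, Finset.sum_apply]

theorem mulVec_eq_zero [Fintype ι] [DecidableEq ι] (hφ : ProductForm φ τ x F) (a : ι → E)
    (h : (Matrix.of fun i' i => x (Pi.single i 1) i') *ᵥ a = 0) : a = 0 := by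
  have := hφ.mulVec_eq (fun i => τ.symm (a i))
  simp only [RingEquiv.apply_symm_apply] at this
  rw [h, ← hφ.col_zero] at this
  have := hφ.col_injective this
  ext i
  have := congrFun this i
  simpa using this.symm

theorem vecMul_eq_zero [Fintype κ] [DecidableEq κ] (hφ : ProductForm φ τ x F) (b : κ → E)
    (h : b ᵥ* (Matrix.of fun j j' => F (Pi.single j 1) j') = 0) : b = 0 := by
  have := hφ.vecMul_eq (fun i => τ.symm (b i))
  simp only [RingEquiv.apply_symm_apply] at this
  rw [h, ← hφ.row_zero] at this
  have := hφ.row_injective this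
  ext i
  have := congrFun this i
  simpa using this.symm

section Linearization

variable [Fintype ι] [Fintype κ] [DecidableEq ι] [DecidableEq κ]

theorem linearization_add (A B : Matrix ι κ D) :
    linearization τ x F (A + B) = linearization τ x F A + linearization τ x F B := by
  have : (A + B).map τ = A.map τ + B.map τ := by
    ext i j
    simp
  rw [linearization, this, Matrix.mul_add, Matrix.add_mul]
  rfl

theorem linearization_vecMulVec (hφ : ProductForm φ τ x F) (u : ι → D) (w : κ → D) :
    linearization τ x F (vecMulVec u w) = vecMulVec (x u) (F w) := by
  have : (vecMulVec u w).map τ = vecMulVec (fun i => τ (u i)) (fun j => τ (w j)) := by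
    ext i j
    simp [vecMulVec_apply]
  rw [linearization, this, mul_vecMulVec, vecMulVec_mul, hφ.mulVec_eq, hφ.vecMul_eq]

/-- The sums of `k` products of a column and a row. -/
def sumsOfProducts (ι κ D : Type*) [DivisionRing D] : ℕ → Set (Matrix ι κ D)
  | 0 => {0}
  | k + 1 => {M | ∃ u w, ∃ N ∈ sumsOfProducts ι κ D k, M = vecMulVec u w + N}

theorem eq_linearization_of_mem (hφ : ProductForm φ τ x F) :
    ∀ k, ∀ M ∈ sumsOfProducts ι κ D (k + 1), φ M = linearization τ x F M
  | 0 => by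
    rintro _ ⟨u, w, _, rfl, rfl⟩
    rw [add_zero, hφ.map_vecMulVec, hφ.linearization_vecMulVec]
  | k + 1 => by
    rintro _ ⟨u, w, _, ⟨u', w', A, hA, rfl⟩, rfl⟩
    have ih : ∀ v y, φ (vecMulVec v y + A) = linearization τ x F (vecMulVec v y + A) :=
      fun v y => eq_linearization_of_mem hφ k _ ⟨v, y, A, hA, rfl⟩
    have hψ : ProductForm (fun M => φ (M + A) - linearization τ x F A) τ x F :=
      { adj := fun M N h => by
          rw [sub_sub_sub_cancel_right]
          exact hφ.adj _ _ (by rwa [add_sub_add_right_eq_sub])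
        map_vecMulVec := fun v y => by
          rw [ih, linearization_add, add_sub_cancel_right, hφ.linearization_vecMulVec]
        row_add := hφ.row_add
        row_smul := hφ.row_smul
        row_ne := hφ.row_ne
        exists_row := hφ.exists_row }
    have := hψ.map_add_vecMulVec u u' w w'
    rw [sub_eq_iff_eq_add] at this
    rw [← add_assoc, this, linearization_add, linearization_add, hφ.linearization_vecMulVec,
      hφ.linearization_vecMulVec]

theorem eq_linearization (hφ : ProductForm φ τ x F) (M : Matrix ι κ D) :
    φ M = linearization τ x F M := by
  have hsum : ∀ s : Finset ι, ∑ i ∈ s, vecMulVec (Pi.single i 1) (M i) ∈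
      sumsOfProducts ι κ D s.card := by
    intro s
    induction s using Finset.induction_on with
    | empty => rfl
    | insert i s hi ih =>
      rw [Finset.sum_insert hi, Finset.card_insert_of_notMem hi]
      exact ⟨_, _, _, ih, rfl⟩
  have hM : M = ∑ i, vecMulVec (Pi.single i 1) (M i) := by
    ext i j
    simp [Matrix.sum_apply, vecMulVec_apply, Pi.single_apply]
  refine hφ.eq_linearization_of_mem (Finset.univ : Finset ι).card M
    ⟨0, 0, M, ?_, by rw [zero_vecMulVec, zero_add]⟩
  rw [hM]
  convert hsum Finset.univ

end Linearization

end ProductForm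

section MatrixForm

variable {E ι κ ι' κ' : Type*} [DivisionRing E]

theorem exists_map_vecMulVec_eq {φ : Matrix ι κ D → Matrix ι' κ' E}
    (hφ : ∀ A B, RankOne (A - B) → RankOne (φ A - φ B)) (h0 : φ 0 = 0) (u : ι → D) (w : κ → D) :
    ∃ x y, φ (vecMulVec u w) = vecMulVec x y := by
  by_cases hu : u = 0
  · exact ⟨0, 0, by simp [hu, h0]⟩
  by_cases hw : w = 0
  · exact ⟨0, 0, by simp [hw, h0, vecMulVec_zero_right]⟩
  obtain ⟨x, y, -, -, e⟩ := hφ (vecMulVec u w) 0 (by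
    rw [sub_zero]
    exact rankOne_vecMulVec hu hw)
  exact ⟨x, y, by rw [← e, h0, sub_zero]⟩

theorem map_vecMulVec_ne_zero {φ : Matrix ι κ D → Matrix ι' κ' E}
    (hφ : ∀ A B, RankOne (A - B) → RankOne (φ A - φ B)) (h0 : φ 0 = 0) {u : ι → D} {w : κ → D}
    (hu : u ≠ 0) (hw : w ≠ 0) : φ (vecMulVec u w) ≠ 0 := by
  have := hφ (vecMulVec u w) 0 (by
    rw [sub_zero]
    exact rankOne_vecMulVec hu hw)
  rw [h0, sub_zero] at this
  exact this.ne_zero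

theorem map_row_dichotomy [Nonempty ι] {φ : Matrix ι κ D → Matrix ι' κ' E}
    (hφ : ∀ A B, RankOne (A - B) → RankOne (φ A - φ B)) (h0 : φ 0 = 0) {w : κ → D} (hw : w ≠ 0) :
    (∃ y : κ' → E, y ≠ 0 ∧ ∀ u, ∃ x, φ (vecMulVec u w) = vecMulVec x y) ∨
      ∃ x : ι' → E, x ≠ 0 ∧ ∀ u, ∃ y, φ (vecMulVec u w) = vecMulVec x y := by
  refine common_row_or_column (fun u => φ (vecMulVec u w)) 1
    (fun u => exists_map_vecMulVec_eq hφ h0 u w)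
    (map_vecMulVec_ne_zero hφ h0 one_ne_zero hw) fun u u' hne => hφ _ _ ?_
  rw [← sub_vecMulVec]
  exact rankOne_vecMulVec (sub_ne_zero.2 fun e => hne (by rw [e])) hw

theorem exists_smul_row_of_eq {x x' : ι → D} {y y' : κ → D} {M : Matrix ι κ D} (hM : M ≠ 0)
    (h : M = vecMulVec x y) (h' : M = vecMulVec x' y') : ∃ c : D, y = c • y' := by
  subst h
  rw [Ne, vecMulVec_eq_zero_iff, not_or] at hM
  obtain ⟨c, -, -, hc⟩ := exists_smul_of_vecMulVec_eq hM.1 hM.2 h'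
  exact ⟨c, hc⟩

theorem exists_smul_col_of_eq {x x' : ι → D} {y y' : κ → D} {M : Matrix ι κ D} (hM : M ≠ 0)
    (h : M = vecMulVec x y) (h' : M = vecMulVec x' y') : ∃ c : Dᵐᵒᵖ, x = c • x' := by
  subst h'
  rw [Ne, vecMulVec_eq_zero_iff, not_or] at hM
  obtain ⟨c, -, hc, -⟩ := exists_smul_of_vecMulVec_eq hM.1 hM.2 h
  exact ⟨_, hc⟩

theorem exists_frame [Nonempty ι] {φ : Matrix ι κ D → Matrix ι' κ' E}
    (hφ : ∀ A B, RankOne (A - B) → RankOne (φ A - φ B)) (h0 : φ 0 = 0) {w₁ w₂ : κ → D}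
    (hw₁ : w₁ ≠ 0) (hw₂ : w₂ ≠ 0) {y₁ y₂ : κ' → E} (hy : Indep E y₁ y₂)
    (h₁ : ∀ u, ∃ x, φ (vecMulVec u w₁) = vecMulVec x y₁)
    (h₂ : ∀ u, ∃ x, φ (vecMulVec u w₂) = vecMulVec x y₂)
    (hN : ∀ x : ι' → E, x ≠ 0 → ∃ u w, ∀ y, φ (vecMulVec u w) ≠ vecMulVec x y) :
    ∃ h g f, Frame φ h g f := by
  have hne := fun {u : ι → D} {w : κ → D} (hu : u ≠ 0) (hw : w ≠ 0) =>
    map_vecMulVec_ne_zero hφ h0 hu hw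
  have hcol : ∀ u : ι → D, u ≠ 0 →
      ∃ x : ι' → E, x ≠ 0 ∧ ∀ w, ∃ y, φ (vecMulVec u w) = vecMulVec x y := by
    intro u hu
    refine (common_row_or_column (fun w => φ (vecMulVec u w)) w₁
      (fun w => exists_map_vecMulVec_eq hφ h0 u w) (hne hu hw₁)
        fun w w' hww => hφ _ _ ?_).resolve_left ?_
    · rw [← vecMulVec_sub]
      exact rankOne_vecMulVec hu (sub_ne_zero.2 fun e => hww (by rw [e]))
    · rintro ⟨y, -, hy'⟩
      obtain ⟨c₁, e₁⟩ := exists_smul_row_of_eq (hne hu hw₁) (h₁ u).choose_spec (hy' w₁).choose_spec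
      obtain ⟨c₂, e₂⟩ := exists_smul_row_of_eq (hne hu hw₂) (h₂ u).choose_spec (hy' w₂).choose_spec
      rw [e₁, e₂] at hy
      exact hy.of_smul_left.of_smul_right.ne rfl
  choose! h hh f hf using hcol
  have hu₁ : (1 : ι → D) ≠ 0 := one_ne_zero
  obtain ⟨u₂, w, huw⟩ := hN (h 1) (hh 1 hu₁)
  have hu₂ : u₂ ≠ 0 := by
    rintro rfl
    exact huw 0 (by rw [zero_vecMulVec, h0, vecMulVec_zero_right])
  have hind : Indep Eᵐᵒᵖ (h u₂) (h 1) := by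
    refine indep_of_forall_ne_smul (hh 1 hu₁) fun c hc => huw (c.unop • f u₂ w) ?_
    rw [hf _ hu₂, hc, ← op_smul_vecMulVec, MulOpposite.op_unop]
  have hrow : ∀ w : κ → D, w ≠ 0 →
      ∃ y : κ' → E, y ≠ 0 ∧ ∀ u, ∃ x, φ (vecMulVec u w) = vecMulVec x y := by
    intro w hw
    refine (map_row_dichotomy hφ h0 hw).resolve_right ?_
    rintro ⟨x, -, hx⟩
    obtain ⟨c₁, e₁⟩ := exists_smul_col_of_eq (hne hu₁ hw) (hf _ hu₁ w) (hx 1).choose_spec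
    obtain ⟨c₂, e₂⟩ := exists_smul_col_of_eq (hne hu₂ hw) (hf _ hu₂ w) (hx u₂).choose_spec
    rw [e₁, e₂] at hind
    exact hind.of_smul_left.of_smul_right.ne rfl
  choose! g hg k hk using hrow
  refine ⟨h, g, f, hφ, h0, fun u w hu => hf u hu w, hh, hg, fun u w hu hw =>
    exists_smul_row_of_eq (hne hu hw) (hf u hu w) (hk w hw u), ⟨_, _, hu₂, hu₁, hind⟩,
    ⟨w₁, w₂, hw₁, hw₂, ?_⟩⟩
  obtain ⟨c₁, e₁⟩ :=
    exists_smul_row_of_eq (hne hu₁ hw₁) (h₁ 1).choose_spec (hk w₁ hw₁ 1)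
  obtain ⟨c₂, e₂⟩ :=
    exists_smul_row_of_eq (hne hu₁ hw₂) (h₂ 1).choose_spec (hk w₂ hw₂ 1)
  rw [e₁, e₂] at hy
  exact hy.of_smul_left.of_smul_right

/-- A preserver of adjacency over whose rows the image has two independent row directions, and not
all of whose products share a column direction, is given by matrix multiplication. -/
theorem exists_eq_mul_map_mul [Nonempty ι] [Fintype ι] [Fintype κ]
    (hsurj : ∀ τ : D →+* E, Function.Surjective τ) (e : D ≃ E) {φ : Matrix ι κ D → Matrix ι' κ' E}
    (hφ : ∀ A B, RankOne (A - B) → RankOne (φ A - φ B)) (h0 : φ 0 = 0) {w₁ w₂ : κ → D}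
    (hw₁ : w₁ ≠ 0) (hw₂ : w₂ ≠ 0) {y₁ y₂ : κ' → E} (hy : Indep E y₁ y₂)
    (h₁ : ∀ u, ∃ x, φ (vecMulVec u w₁) = vecMulVec x y₁)
    (h₂ : ∀ u, ∃ x, φ (vecMulVec u w₂) = vecMulVec x y₂)
    (hN : ∀ x : ι' → E, x ≠ 0 → ∃ u w, ∀ y, φ (vecMulVec u w) ≠ vecMulVec x y) :
    ∃ (τ : D ≃+* E) (P : Matrix ι' ι E) (Q : Matrix κ κ' E), (∀ a, P *ᵥ a = 0 → a = 0) ∧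
      (∀ b, b ᵥ* Q = 0 → b = 0) ∧ ∀ M, φ M = P * M.map τ * Q := by
  classical
  obtain ⟨h, g, f, hF⟩ := exists_frame hφ h0 hw₁ hw₂ hy h₁ h₂ hN
  obtain ⟨τ, x, F, hP⟩ := hF.exists_productForm hsurj e
  exact ⟨τ, _, _, hP.mulVec_eq_zero, hP.vecMul_eq_zero, hP.eq_linearization⟩

end MatrixForm

section Duality

variable {ι κ μ : Type*}

/-- The transpose, as a matrix over the opposite ring. -/
def opTranspose (M : Matrix ι κ D) : Matrix κ ι Dᵐᵒᵖ := Matrix.of fun j i => MulOpposite.op (M i j)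

/-- The transpose of a matrix over the opposite ring. -/
def unopTranspose (M : Matrix ι κ Dᵐᵒᵖ) : Matrix κ ι D :=
  Matrix.of fun j i => MulOpposite.unop (M i j)

theorem unopTranspose_mul [Fintype κ] (M : Matrix ι κ Dᵐᵒᵖ) (N : Matrix κ μ Dᵐᵒᵖ) :
    unopTranspose (M * N) = unopTranspose N * unopTranspose M := by
  ext i j
  simp [unopTranspose, mul_apply, Finset.unop_sum]

theorem opTranspose_vecMulVec (x : ι → D) (y : κ → D) :
    opTranspose (vecMulVec x y) =
      vecMulVec (fun j => MulOpposite.op (y j)) (fun i => MulOpposite.op (x i)) := rfl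

theorem unopTranspose_vecMulVec (x : ι → Dᵐᵒᵖ) (y : κ → Dᵐᵒᵖ) :
    unopTranspose (vecMulVec x y) =
      vecMulVec (fun j => MulOpposite.unop (y j)) (fun i => MulOpposite.unop (x i)) := rfl

theorem op_comp_ne_zero {x : ι → D} (hx : x ≠ 0) : (fun i => MulOpposite.op (x i)) ≠ 0 :=
  fun e => hx (funext fun i => MulOpposite.op_injective (congrFun e i))

theorem unop_comp_ne_zero {x : ι → Dᵐᵒᵖ} (hx : x ≠ 0) : (fun i => MulOpposite.unop (x i)) ≠ 0 :=
  fun e => hx (funext fun i => MulOpposite.unop_injective (congrFun e i))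

theorem RankOne.opTranspose {M : Matrix ι κ D} (h : RankOne M) : RankOne (opTranspose M) := by
  obtain ⟨x, y, hx, hy, rfl⟩ := h
  exact rankOne_vecMulVec (op_comp_ne_zero hy) (op_comp_ne_zero hx)

theorem Indep.op_comp {x y : ι → D} (h : Indep Dᵐᵒᵖ x y) :
    Indep Dᵐᵒᵖ (fun i => MulOpposite.op (x i)) (fun i => MulOpposite.op (y i)) := fun s t e =>
  h s t (funext fun i => MulOpposite.op_injective (congrFun e i))

theorem surjective_of_ringHom_mulOpposite (hD : ∀ f : D →+* D, Function.Surjective f)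
    (τ : D →+* Dᵐᵒᵖ) : Function.Surjective τ := by
  let f : D →+* D := RingHom.mk' ⟨⟨fun d => (τ (τ d).unop).unop, by simp⟩, fun a b => by simp⟩
    (fun a b => by simp)
  intro c
  obtain ⟨d, hd⟩ := hD f c.unop
  exact ⟨_, MulOpposite.unop_injective hd⟩

end Duality

section Completion

theorem exists_isUnit_rows {b q : ℕ} (Q : Matrix (Fin b) (Fin q) D)
    (hQ : ∀ v, v ᵥ* Q = 0 → v = 0) :
    ∃ h : b ≤ q, ∃ S : Matrix (Fin q) (Fin q) D, IsUnit S ∧ ∀ i, S (Fin.castLE h i) = Q i := by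
  have hli : LinearIndependent D (fun i : Fin b => Q i) := by
    rw [Fintype.linearIndependent_iff]
    intro v hv
    refine congrFun (hQ v ?_)
    rw [← hv]
    ext j
    simp [vecMul, dotProduct, Finset.sum_apply]
  let B : Module.Basis (Fin b ⊕ Module.Basis.sumExtendIndex hli) D (Fin q → D) :=
    Module.Basis.sumExtend hli
  have : Finite (Fin b ⊕ Module.Basis.sumExtendIndex hli) :=
    Module.Finite.finite_basis B
  have : Finite (Module.Basis.sumExtendIndex hli) := Finite.sum_right (Fin b)
  have := Fintype.ofFinite (Module.Basis.sumExtendIndex hli)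
  have hcard : b + Fintype.card (Module.Basis.sumExtendIndex hli) = q := by
    have := Module.finrank_eq_card_basis B
    rw [Module.finrank_fin_fun, Fintype.card_sum, Fintype.card_fin] at this
    exact this.symm
  have hbq : b ≤ q := hcard ▸ Nat.le_add_right _ _
  let e : Fin b ⊕ Module.Basis.sumExtendIndex hli ≃ Fin q :=
    ((Equiv.refl _).sumCongr (Fintype.equivFin _)).trans (finSumFinEquiv.trans (finCongr hcard))
  have he : ∀ i, e.symm (Fin.castLE hbq i) = Sum.inl i := fun i => by
    rw [Equiv.symm_apply_eq]
    rfl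
  let B' := B.reindex e
  let S : Matrix (Fin q) (Fin q) D := Matrix.of fun i => B' i
  refine ⟨hbq, S, ?_, fun i => ?_⟩
  · let N : Matrix (Fin q) (Fin q) D := Matrix.of fun j => B'.repr (Pi.single j 1)
    have hNS : N * S = 1 := by
      ext j k
      have := congrFun (B'.sum_repr (Pi.single j (1 : D))) k
      rw [Finset.sum_apply] at this
      rw [mul_apply, one_apply]
      refine this.trans ?_
      rw [Pi.single_apply]
      simp only [eq_comm]
    exact ⟨⟨S, N, mul_eq_one_symm hNS, hNS⟩, rfl⟩
  · change B' _ = _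
    rw [Module.Basis.reindex_apply, he]
    simp only [B, Module.Basis.sumExtend, Module.Basis.reindex_apply, Module.Basis.coe_extend]
    rfl

theorem exists_isUnit_cols {a p : ℕ} (P : Matrix (Fin p) (Fin a) D)
    (hP : ∀ v, P *ᵥ v = 0 → v = 0) :
    ∃ h : a ≤ p, ∃ T : Matrix (Fin p) (Fin p) D, IsUnit T ∧
      ∀ i j, T i (Fin.castLE h j) = P i j := by
  obtain ⟨h, S, hS, hSP⟩ := exists_isUnit_rows (opTranspose P) (fun v hv => by
    have := hP (fun j => (v j).unop) (funext fun i => by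
      have := congrArg MulOpposite.unop (congrFun hv i)
      simpa [vecMul, mulVec, dotProduct, opTranspose, Finset.unop_sum] using this)
    exact funext fun j => MulOpposite.unop_injective (congrFun this j))
  have hone : unopTranspose (1 : Matrix (Fin p) (Fin p) Dᵐᵒᵖ) = 1 := by
    ext i j
    by_cases hij : i = j
    · subst hij
      simp [unopTranspose]
    · simp [unopTranspose, hij, Ne.symm hij]
  refine ⟨h, unopTranspose S, ?_, fun i j => ?_⟩
  · obtain ⟨u, rfl⟩ := hS
    exact ⟨⟨unopTranspose u.1, unopTranspose u.2, by rw [← unopTranspose_mul, u.inv_val, hone],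
      by rw [← unopTranspose_mul, u.val_inv, hone]⟩, rfl⟩
  · exact congrArg MulOpposite.unop (congrFun (hSP j) i)

theorem mul_pad_mul {a b p q : ℕ} (ha : a ≤ p) (hb : b ≤ q) (T : Matrix (Fin p) (Fin p) D)
    (S : Matrix (Fin q) (Fin q) D) (B : Matrix (Fin a) (Fin b) D) :
    T * pad p q B * S = (Matrix.of fun i j => T i (Fin.castLE ha j)) * B *
      (Matrix.of fun i j => S (Fin.castLE hb i) j) := by
  let J : Matrix (Fin p) (Fin a) D := Matrix.of fun i j => if i = Fin.castLE ha j then 1 else 0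
  let J' : Matrix (Fin b) (Fin q) D := Matrix.of fun i j => if Fin.castLE hb i = j then 1 else 0
  have hpad : pad p q B = J * B * J' := by
    ext i j
    have hi : ∀ k, (J * B) i k = if hi : (i : ℕ) < a then B ⟨i, hi⟩ k else 0 := by
      intro k
      simp only [mul_apply, J, of_apply, ite_mul, one_mul, zero_mul]
      split_ifs with hi
      · rw [Finset.sum_eq_single ⟨i, hi⟩ (fun l _ hl => if_neg fun e => hl (by
          ext
          simp [e])) (fun h => absurd (Finset.mem_univ _) h)]
        exact if_pos rfl
      · exact Finset.sum_eq_zero fun l _ => if_neg fun e => hi (by rw [e]; exact l.2)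
    rw [mul_apply]
    simp only [J', of_apply, mul_ite, mul_one, mul_zero, hi, pad]
    split_ifs with hi hj
    · rw [Finset.sum_eq_single ⟨j, hj⟩ (fun l _ hl => if_neg fun e => hl (by
        ext
        simp [← e])) (fun h => absurd (Finset.mem_univ _) h)]
      exact (if_pos rfl).symm
    · exact (Finset.sum_eq_zero fun l _ => if_neg fun e => hj (by rw [← e]; exact l.2)).symm
    · simp
  have hT : T * J = Matrix.of fun i j => T i (Fin.castLE ha j) := by
    ext i j
    simp [mul_apply, J]
  have hS : J' * S = Matrix.of fun i j => S (Fin.castLE hb i) j := by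
    ext i j
    simp [mul_apply, J']
  rw [hpad, ← hT, ← hS]
  simp only [Matrix.mul_assoc]

theorem exists_isUnit_mul_pad_mul {a b p q : ℕ} (P : Matrix (Fin p) (Fin a) D)
    (Q : Matrix (Fin b) (Fin q) D) (hP : ∀ v, P *ᵥ v = 0 → v = 0)
    (hQ : ∀ v, v ᵥ* Q = 0 → v = 0) :
    a ≤ p ∧ b ≤ q ∧ ∃ T : Matrix (Fin p) (Fin p) D, ∃ S : Matrix (Fin q) (Fin q) D,
      IsUnit T ∧ IsUnit S ∧ ∀ B : Matrix (Fin a) (Fin b) D, P * B * Q = T * pad p q B * S := by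
  obtain ⟨ha, T, hT, hTP⟩ := exists_isUnit_cols P hP
  obtain ⟨hb, S, hS, hSQ⟩ := exists_isUnit_rows Q hQ
  refine ⟨ha, hb, T, S, hT, hS, fun B => ?_⟩
  rw [mul_pad_mul ha hb]
  congr
  · ext i j
    exact (hTP i j).symm
  · ext i j
    exact (congrFun (hSQ i) j).symm

end Completion

section RowRank

theorem exists_eq_vecMulVec_of_rowRank_le_one {m n : ℕ} {M : Matrix (Fin m) (Fin n) D}
    (h : rowRank M ≤ 1) : ∃ x y, M = vecMulVec x y := by
  obtain ⟨v, hv⟩ := finrank_le_one_iff.1 h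
  choose c hc using fun i => hv ⟨M i, Submodule.subset_span ⟨i, rfl⟩⟩
  refine ⟨c, v, ?_⟩
  ext i j
  exact congrFun (congrArg Subtype.val (hc i)).symm j

theorem rowRank_eq_one_iff {m n : ℕ} {M : Matrix (Fin m) (Fin n) D} :
    rowRank M = 1 ↔ RankOne M := by
  constructor
  · intro h
    obtain ⟨x, y, rfl⟩ := exists_eq_vecMulVec_of_rowRank_le_one h.le
    have hne : vecMulVec x y ≠ 0 := by
      intro h0
      rw [h0, rowRank] at h
      have : Submodule.span D (Set.range fun i => (0 : Matrix (Fin m) (Fin n) D) i) = ⊥ := by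
        rw [Submodule.span_eq_bot]
        rintro _ ⟨i, rfl⟩
        rfl
      rw [this, finrank_bot] at h
      exact zero_ne_one h
    rw [Ne, vecMulVec_eq_zero_iff, not_or] at hne
    exact rankOne_vecMulVec hne.1 hne.2
  · rintro ⟨x, y, hx, hy, rfl⟩
    have : Submodule.span D (Set.range fun i => vecMulVec x y i) = D ∙ y := by
      apply le_antisymm
      · rw [Submodule.span_le]
        rintro _ ⟨i, rfl⟩
        exact Submodule.mem_span_singleton.2 ⟨x i, rfl⟩
      · rw [Submodule.span_singleton_le_iff_mem]
        obtain ⟨i, hi⟩ := Function.ne_iff.1 hx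
        have := Submodule.smul_mem _ (x i)⁻¹
          (Submodule.subset_span (s := Set.range fun i => vecMulVec x y i) (R := D) ⟨i, rfl⟩)
        convert this using 1
        ext j
        simp [vecMulVec_apply, inv_mul_cancel_left₀ hi]
    rw [rowRank, this, finrank_span_singleton hy]

end RowRank

section Standard

variable {m n p q : ℕ} {φ : Matrix (Fin m) (Fin n) D → Matrix (Fin p) (Fin q) D}

theorem exists_forall_vecMulVec_ne_of_not_degZero (hdeg : ¬ DegZero φ) {x : Fin p → D}
    {y : Fin q → D} (hx : x ≠ 0) (hy : y ≠ 0) :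
    ∃ u w, (∀ z, φ (vecMulVec u w) ≠ vecMulVec z y) ∧ ∀ z, φ (vecMulVec u w) ≠ vecMulVec x z := by
  by_contra! hcon
  refine hdeg ⟨x, hx, y, hy, fun M hM => ?_⟩
  obtain ⟨u, w, rfl⟩ := exists_eq_vecMulVec_of_rowRank_le_one hM
  by_cases h : ∃ z, φ (vecMulVec u w) = vecMulVec z y
  · obtain ⟨z, hz⟩ := h
    exact Or.inl ⟨z, fun i j => by rw [hz, vecMulVec_apply]⟩
  · obtain ⟨z, hz⟩ := hcon u w (not_exists.1 h)
    exact Or.inr ⟨z, fun i j => by rw [hz, vecMulVec_apply]⟩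

/-- A nondegenerate preserver with two independent row directions is standard. -/
theorem standard_of_indep_rows [Nonempty (Fin m)] (hD : EAS D)
    (hφ : ∀ A B, RankOne (A - B) → RankOne (φ A - φ B)) (h0 : φ 0 = 0) (hdeg : ¬ DegZero φ)
    {w₁ w₂ : Fin n → D} (hw₁ : w₁ ≠ 0) (hw₂ : w₂ ≠ 0) {y₁ y₂ : Fin q → D}
    (hy : Indep D y₁ y₂) (h₁ : ∀ u, ∃ x, φ (vecMulVec u w₁) = vecMulVec x y₁)
    (h₂ : ∀ u, ∃ x, φ (vecMulVec u w₂) = vecMulVec x y₂) : Standard φ := by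
  obtain ⟨τ, P, Q, hP, hQ, hPQ⟩ := exists_eq_mul_map_mul hD (Equiv.refl D) hφ h0 hw₁ hw₂ hy h₁ h₂
    fun x hx => by
      obtain ⟨u, w, -, h⟩ := exists_forall_vecMulVec_ne_of_not_degZero hdeg hx hy.left_ne_zero
      exact ⟨u, w, h⟩
  obtain ⟨ha, hb, T, S, hT, hS, hTS⟩ := exists_isUnit_mul_pad_mul P Q hP hQ
  exact Or.inl ⟨ha, hb, τ, T, S, 0, hT, hS, fun A => by rw [hPQ, hTS, add_zero]⟩

/-- A nondegenerate preserver with two independent column directions is standard. -/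
theorem standard_of_indep_cols [Nonempty (Fin m)] (hD : EAS D)
    (hφ : ∀ A B, RankOne (A - B) → RankOne (φ A - φ B)) (h0 : φ 0 = 0) (hdeg : ¬ DegZero φ)
    {w₁ w₂ : Fin n → D} (hw₁ : w₁ ≠ 0) (hw₂ : w₂ ≠ 0) {x₁ x₂ : Fin p → D}
    (hx : Indep Dᵐᵒᵖ x₁ x₂) (h₁ : ∀ u, ∃ y, φ (vecMulVec u w₁) = vecMulVec x₁ y)
    (h₂ : ∀ u, ∃ y, φ (vecMulVec u w₂) = vecMulVec x₂ y) : Standard φ := by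
  have hcol : ∀ {w x}, (∀ u, ∃ y, φ (vecMulVec u w) = vecMulVec x y) →
      ∀ u, ∃ z, opTranspose (φ (vecMulVec u w)) =
        vecMulVec z (fun i => MulOpposite.op (x i)) := by
    intro w x h u
    obtain ⟨y, hy⟩ := h u
    exact ⟨_, by rw [hy, opTranspose_vecMulVec]⟩
  obtain ⟨τ, P, Q, hP, hQ, hPQ⟩ := exists_eq_mul_map_mul (φ := fun M => opTranspose (φ M))
    (surjective_of_ringHom_mulOpposite hD) MulOpposite.opEquiv
    (fun A B h => (hφ A B h).opTranspose) (by rw [h0]; rfl) hw₁ hw₂ hx.op_comp (hcol h₁) (hcol h₂)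
    fun z hz => by
      obtain ⟨u, w, h, -⟩ :=
        exists_forall_vecMulVec_ne_of_not_degZero hdeg hx.left_ne_zero (unop_comp_ne_zero hz)
      exact ⟨u, w, fun y hy => h _ ((congrArg unopTranspose hy).trans
        (unopTranspose_vecMulVec z y))⟩
  obtain ⟨ha, hb, T, S, hT, hS, hTS⟩ := exists_isUnit_mul_pad_mul (unopTranspose Q)
    (unopTranspose P)
    (fun v hv => by
      have := hQ (fun j => MulOpposite.op (v j)) (funext fun i => by
        have := congrArg MulOpposite.op (congrFun hv i)
        simpa [vecMul, mulVec, dotProduct, unopTranspose, Finset.op_sum] using this)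
      exact funext fun j => MulOpposite.op_injective (congrFun this j))
    (fun v hv => by
      have := hP (fun j => MulOpposite.op (v j)) (funext fun i => by
        have := congrArg MulOpposite.op (congrFun hv i)
        simpa [vecMul, mulVec, dotProduct, unopTranspose, Finset.op_sum] using this)
      exact funext fun j => MulOpposite.op_injective (congrFun this j))
  refine Or.inr ⟨ha, hb, fun a => (τ a).unop, MulOpposite.unop_bijective.comp τ.bijective,
    by simp, by simp, by simp, T, S, 0, hT, hS, fun A => ?_⟩
  have := congrArg unopTranspose (hPQ A)
  rw [unopTranspose_mul, unopTranspose_mul, ← Matrix.mul_assoc] at this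
  rw [add_zero, ← hTS]
  exact this

theorem standard_of_not_degZero [Nonempty (Fin m)] (hp : 0 < p) (hq : 0 < q) (hD : EAS D)
    (hφ : ∀ A B, RankOne (A - B) → RankOne (φ A - φ B)) (h0 : φ 0 = 0) (hdeg : ¬ DegZero φ) :
    Standard φ := by
  by_contra hst
  obtain ⟨y₀, hy₀, hrow⟩ : ∃ y₀ : Fin q → D, y₀ ≠ 0 ∧ ∀ w y, w ≠ 0 → y ≠ 0 →
      (∀ u, ∃ x, φ (vecMulVec u w) = vecMulVec x y) →
      ∀ u, ∃ x, φ (vecMulVec u w) = vecMulVec x y₀ := by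
    by_cases h : ∃ w y, w ≠ 0 ∧ y ≠ 0 ∧ ∀ u, ∃ x, φ (vecMulVec u w) = vecMulVec x y
    · obtain ⟨w₁, y₁, hw₁, hy₁, h₁⟩ := h
      refine ⟨y₁, hy₁, fun w y hw hy hwy u => ?_⟩
      obtain ⟨c, rfl⟩ := exists_smul_of_not_indep
        (fun hi => hst (standard_of_indep_rows hD hφ h0 hdeg hw hw₁ hi hwy h₁)) hy₁
      obtain ⟨x, hx⟩ := hwy u
      exact ⟨_, by rw [hx, ← op_smul_vecMulVec]⟩
    · push Not at h
      refine ⟨fun _ => 1, fun e => one_ne_zero (congrFun e ⟨0, hq⟩), fun w y hw hy hwy => ?_⟩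
      obtain ⟨u, hu⟩ := h w y hw hy
      obtain ⟨x, hx⟩ := hwy u
      exact absurd hx (hu x)
  obtain ⟨x₀, hx₀, hcol⟩ : ∃ x₀ : Fin p → D, x₀ ≠ 0 ∧ ∀ w x, w ≠ 0 → x ≠ 0 →
      (∀ u, ∃ y, φ (vecMulVec u w) = vecMulVec x y) →
      ∀ u, ∃ y, φ (vecMulVec u w) = vecMulVec x₀ y := by
    by_cases h : ∃ w x, w ≠ 0 ∧ x ≠ 0 ∧ ∀ u, ∃ y, φ (vecMulVec u w) = vecMulVec x y
    · obtain ⟨w₁, x₁, hw₁, hx₁, h₁⟩ := h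
      refine ⟨x₁, hx₁, fun w x hw hx hwx u => ?_⟩
      obtain ⟨c, rfl⟩ := exists_smul_of_not_indep
        (fun hi => hst (standard_of_indep_cols hD hφ h0 hdeg hw hw₁ hi hwx h₁)) hx₁
      obtain ⟨y, hy⟩ := hwx u
      exact ⟨_, by rw [hy, ← MulOpposite.op_unop c, op_smul_vecMulVec]⟩
    · push Not at h
      refine ⟨fun _ => 1, fun e => one_ne_zero (congrFun e ⟨0, hp⟩), fun w x hw hx hwx => ?_⟩
      obtain ⟨u, hu⟩ := h w x hw hx
      obtain ⟨y, hy⟩ := hwx u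
      exact absurd hy (hu y)
  obtain ⟨u, w, hr, hc⟩ := exists_forall_vecMulVec_ne_of_not_degZero hdeg hx₀ hy₀
  have hw : w ≠ 0 := by
    rintro rfl
    exact hr 0 (by rw [vecMulVec_zero_right, h0, zero_vecMulVec])
  rcases map_row_dichotomy hφ h0 hw with ⟨y, hy, h⟩ | ⟨x, hx, h⟩
  · obtain ⟨x, hx⟩ := hrow w y hw hy h u
    exact hr x hx
  · obtain ⟨y, hy⟩ := hcol w x hw hx h u
    exact hc y hy

end Standard

end AdjacencyPreserver

/-- Proposition 3.17. -/
theorem stmt15 (hEAS : EAS D) (m n p q : ℕ) (hm : 0 < m) (hn : 0 < n) (hp : 0 < p)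
    (hq : 0 < q)
    (φ : Matrix (Fin m) (Fin n) D → Matrix (Fin p) (Fin q) D)
    (hφ : ∀ A B, Adjacent A B → Adjacent (φ A) (φ B)) (h0 : φ 0 = 0)
    (hdeg : ¬ DegZero φ) :
    Standard φ := by
  have : Nonempty (Fin m) := Fin.pos_iff_nonempty.1 hm
  exact AdjacencyPreserver.standard_of_not_degZero hp hq hEAS
    (fun A B h => AdjacencyPreserver.rowRank_eq_one_iff.1
      (hφ A B (AdjacencyPreserver.rowRank_eq_one_iff.2 h))) h0 hdeg
end

section
/- Let p, q be integers with p ≥ 2 and q ≥ 2, let F be a finite field, and let φ : M_2(F) → M_{p×q}(F) be a degenerate adjacency preserver such that φ(0) = 0. Then φ(A) has rank at most 1 for all A ∈ M_2(F). -/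
open Matrix

variable {D : Type*} [DivisionRing D]

theorem rowRank_le_one_of_mem_Rvec {F : Type*} [Field F] {m n : ℕ}
    {M : Matrix (Fin m) (Fin n) F} {y : Fin n → F} (h : M ∈ Rvec y) : rowRank M ≤ 1 := by
  obtain ⟨u, hu⟩ := h
  have hle : Submodule.span F (Set.range fun i => M i) ≤ Submodule.span F {y} := by
    rw [Submodule.span_le]
    rintro _ ⟨i, rfl⟩
    exact Submodule.mem_span_singleton.2 ⟨u i, funext fun j => (hu i j).symm⟩
  exact (Submodule.finrank_mono hle).trans (finrank_span_le_card ({y} : Set (Fin n → F)) |>.trans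
    (by simp))

theorem rowRank_pos_of_ne_zero {F : Type*} [Field F] {m n : ℕ}
    {M : Matrix (Fin m) (Fin n) F} (h : M ≠ 0) : 0 < rowRank M := by
  rw [Nat.pos_iff_ne_zero]
  intro h0
  rw [rowRank, Submodule.finrank_eq_zero, Submodule.span_eq_bot] at h0
  exact h (funext fun i => h0 _ ⟨i, rfl⟩)

theorem rowRank_vecMulVec_le_one {F : Type*} [Field F] {m n : ℕ} (u : Fin m → F)
    (v : Fin n → F) : rowRank (vecMulVec u v) ≤ 1 :=
  rowRank_le_one_of_mem_Rvec ⟨u, fun _ _ => rfl⟩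

theorem minor_eq_of_rowRank_le_one {F : Type*} [Field F] {m n : ℕ}
    {M : Matrix (Fin m) (Fin n) F} (h : rowRank M ≤ 1) (i i' : Fin m) (j j' : Fin n) :
    M i j * M i' j' = M i j' * M i' j := by
  obtain ⟨v, hv⟩ := finrank_le_one_iff.1 h
  have key : ∀ i, ∃ c : F, ∀ j, M i j = c * v.1 j := fun i => by
    obtain ⟨c, hc⟩ := hv ⟨M i, Submodule.subset_span ⟨i, rfl⟩⟩
    exact ⟨c, fun j => (congrFun (congrArg Subtype.val hc) j).symm⟩
  obtain ⟨c, hc⟩ := key i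
  obtain ⟨c', hc'⟩ := key i'
  rw [hc, hc', hc, hc']
  ring

theorem Adjacent.ne {F : Type*} [Field F] {m n : ℕ} {A B : Matrix (Fin m) (Fin n) F}
    (h : Adjacent A B) : A ≠ B := by
  rintro rfl
  have h1 : rowRank (A - A) = 1 := h
  have h0 : rowRank (A - A) = 0 := by
    rw [rowRank, Submodule.finrank_eq_zero, Submodule.span_eq_bot]
    rintro _ ⟨i, rfl⟩
    exact congrFun (sub_self A) i
  omega

theorem vecMulVec_ne_zero_of_ne_zero {F : Type*} [Field F] {m n : ℕ} {u : Fin m → F}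
    {v : Fin n → F} (hu : u ≠ 0) (hv : v ≠ 0) : vecMulVec u v ≠ 0 := by
  obtain ⟨i, hi⟩ := Function.ne_iff.1 hu
  obtain ⟨j, hj⟩ := Function.ne_iff.1 hv
  exact fun h => mul_ne_zero hi hj (congrFun (congrFun h i) j)

theorem adjacent_add_vecMulVec_left {F : Type*} [Field F] {m n : ℕ}
    (P : Matrix (Fin m) (Fin n) F) {u u' : Fin m → F} {v : Fin n → F} (hu : u ≠ u')
    (hv : v ≠ 0) : Adjacent (P + vecMulVec u v) (P + vecMulVec u' v) := by
  have h : P + vecMulVec u v - (P + vecMulVec u' v) = vecMulVec (u - u') v := by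
    rw [sub_vecMulVec]; abel
  rw [Adjacent, h]
  exact le_antisymm (rowRank_vecMulVec_le_one _ _)
    (rowRank_pos_of_ne_zero (vecMulVec_ne_zero_of_ne_zero (sub_ne_zero.2 hu) hv))

theorem adjacent_add_vecMulVec_right {F : Type*} [Field F] {m n : ℕ}
    (P : Matrix (Fin m) (Fin n) F) {u : Fin m → F} {v v' : Fin n → F} (hu : u ≠ 0)
    (hv : v ≠ v') : Adjacent (P + vecMulVec u v) (P + vecMulVec u v') := by
  have h : P + vecMulVec u v - (P + vecMulVec u v') = vecMulVec u (v - v') := by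
    rw [vecMulVec_sub]; abel
  rw [Adjacent, h]
  exact le_antisymm (rowRank_vecMulVec_le_one _ _)
    (rowRank_pos_of_ne_zero (vecMulVec_ne_zero_of_ne_zero hu (sub_ne_zero.2 hv)))

theorem Rvec_sub_mem {F : Type*} [Field F] {m n : ℕ} {y : Fin n → F}
    {M N : Matrix (Fin m) (Fin n) F} (hM : M ∈ Rvec y) (hN : N ∈ Rvec y) :
    M - N ∈ Rvec y := by
  obtain ⟨u, hu⟩ := hM
  obtain ⟨v, hv⟩ := hN
  exact ⟨u - v, fun i j => by simp [hu, hv, sub_mul]⟩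

/-- An adjacent set inside a cross lies in one arm of the cross. -/
theorem forall_mem_Rvec_or_forall_mem_Lvec {F : Type*} [Field F] {p q : ℕ} {V : Type*}
    {x : Fin p → F} {y : Fin q → F} (hx : x ≠ 0) (hy : y ≠ 0)
    (G : V → Matrix (Fin p) (Fin q) F) (hG : ∀ a b, a ≠ b → Adjacent (G a) (G b))
    (hmem : ∀ a, G a ∈ Rvec y ∪ Lvec x) :
    (∀ a, G a ∈ Rvec y) ∨ (∀ a, G a ∈ Lvec x) := by
  by_contra! hcon
  obtain ⟨⟨a, ha⟩, b, hb⟩ := hcon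
  obtain ⟨v, hv⟩ := (hmem a).resolve_left ha
  obtain ⟨u, hu⟩ := (hmem b).resolve_right hb
  have hab : a ≠ b := by
    rintro rfl
    exact ha ⟨u, hu⟩
  have hrank : rowRank (G a - G b) ≤ 1 := (hG a b hab).le
  obtain ⟨i₀, hi₀⟩ := Function.ne_iff.1 hx
  obtain ⟨j₀, hj₀⟩ := Function.ne_iff.1 hy
  simp only [Pi.zero_apply] at hi₀ hj₀
  have hprod : ∀ i j, (x i₀ * u i - x i * u i₀) * (v j₀ * y j - v j * y j₀) = 0 := by
    intro i j
    have := minor_eq_of_rowRank_le_one hrank i₀ i j₀ j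
    simp only [Matrix.sub_apply, hv, hu] at this
    linear_combination -this
  by_cases hpar : ∀ i, x i₀ * u i - x i * u i₀ = 0
  · refine hb ⟨fun j => u i₀ / x i₀ * y j, fun i j => ?_⟩
    rw [hu]
    field_simp
    linear_combination y j * hpar i
  · push Not at hpar
    obtain ⟨i, hi⟩ := hpar
    refine ha ⟨fun i => v j₀ / y j₀ * x i, fun k j => ?_⟩
    have := (mul_eq_zero.1 (hprod i j)).resolve_left hi
    rw [hv]
    field_simp
    linear_combination -x k * this

/-- Over a finite field, `R(y) ∩ L(ᵗx)` has too few elements to receive injectively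
a line together with a point outside it. -/
theorem not_line_and_point_mem_inter {F : Type*} [Field F] [Finite F] {p q : ℕ} {V : Type*}
    [AddCommGroup V] [Module F V] {x : Fin p → F} {y : Fin q → F} (hx : x ≠ 0)
    {G : V → Matrix (Fin p) (Fin q) F} (hG : Function.Injective G) {k₁ k₂ : V}
    (hk₁ : k₁ ≠ 0) (hk : ∀ t : F, t • k₁ ≠ k₂)
    (hR : ∀ t : F, G (t • k₁) ∈ Rvec y) (hL : ∀ t : F, G (t • k₁) ∈ Lvec x)
    (hR₂ : G k₂ ∈ Rvec y) (hL₂ : G k₂ ∈ Lvec x) : False := by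
  obtain ⟨i₀, hi₀⟩ := Function.ne_iff.1 hx
  simp only [Pi.zero_apply] at hi₀
  have key : ∀ M : Matrix (Fin p) (Fin q) F, M ∈ Rvec y → M ∈ Lvec x →
      ∃ c : F, ∀ i j, M i j = c * (x i * y j) := by
    rintro M ⟨u, hu⟩ ⟨v, hv⟩
    refine ⟨u i₀ / x i₀, fun i j => ?_⟩
    have := (hu i₀ j).symm.trans (hv i₀ j)
    rw [hv]
    field_simp
    linear_combination -x i * this
  choose f hf using fun t => key _ (hR t) (hL t)
  obtain ⟨c, hc⟩ := key _ hR₂ hL₂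
  have hinj : Function.Injective f := fun s t hst => by
    have : G (s • k₁) = G (t • k₁) := by
      ext i j
      rw [hf, hf, hst]
    exact smul_left_injective F hk₁ (hG this)
  obtain ⟨t, rfl⟩ := Finite.surjective_of_injective hinj c
  exact hk t (hG (by ext i j; rw [hf, hc]))

theorem add_sub_injective_left {F : Type*} [Field F] {m n p q : ℕ}
    {φ : Matrix (Fin m) (Fin n) F → Matrix (Fin p) (Fin q) F}
    (hφ : ∀ A B, Adjacent A B → φ A ≠ φ B) (P : Matrix (Fin m) (Fin n) F) {z : Fin n → F}
    (hz : z ≠ 0) : Function.Injective fun u => φ (P + vecMulVec u z) - φ P := by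
  intro u u' h
  by_contra hu
  exact hφ _ _ (adjacent_add_vecMulVec_left P hu hz) (sub_left_injective h)

/-- A degenerate adjacency preserver maps each ball into a single arm of the cross. -/
theorem ball_subset_Rvec_or_Lvec {F : Type*} [Field F] [Finite F] {p q : ℕ}
    {φ : Matrix (Fin 2) (Fin 2) F → Matrix (Fin p) (Fin q) F}
    (hφ : ∀ A B, Adjacent A B → Adjacent (φ A) (φ B)) {P : Matrix (Fin 2) (Fin 2) F}
    (hdeg : DegenerateAt φ P) :
    (∃ y : Fin q → F, y ≠ 0 ∧ ∀ u v, φ (P + vecMulVec u v) - φ P ∈ Rvec y) ∨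
    (∃ x : Fin p → F, x ≠ 0 ∧ ∀ u v, φ (P + vecMulVec u v) - φ P ∈ Lvec x) := by
  obtain ⟨x, hx, y, hy, hxy⟩ := hdeg
  have hmem : ∀ u v, φ (P + vecMulVec u v) - φ P ∈ Rvec y ∪ Lvec x :=
    fun u v => hxy _ (rowRank_vecMulVec_le_one u v)
  have hadj : ∀ {A B}, Adjacent A B → Adjacent (φ A - φ P) (φ B - φ P) := fun {A B} h => by
    rw [Adjacent, sub_sub_sub_cancel_right]
    exact hφ A B h
  have hrow : ∀ z : Fin 2 → F, z ≠ 0 → (∀ u, φ (P + vecMulVec u z) - φ P ∈ Rvec y) ∨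
      (∀ u, φ (P + vecMulVec u z) - φ P ∈ Lvec x) := fun z hz =>
    forall_mem_Rvec_or_forall_mem_Lvec hx hy _
      (fun _ _ h => hadj (adjacent_add_vecMulVec_left P h hz)) fun u => hmem u z
  have hcol : ∀ k : Fin 2 → F, k ≠ 0 → (∀ v, φ (P + vecMulVec k v) - φ P ∈ Rvec y) ∨
      (∀ v, φ (P + vecMulVec k v) - φ P ∈ Lvec x) := fun k hk =>
    forall_mem_Rvec_or_forall_mem_Lvec hx hy _
      (fun _ _ h => hadj (adjacent_add_vecMulVec_right P hk h)) fun v => hmem k v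
  have hinj := fun {z : Fin 2 → F} (hz : z ≠ 0) =>
    add_sub_injective_left (fun A B h => (hφ A B h).ne) P hz
  have hRL : ∀ z k₁ k₂ : Fin 2 → F, z ≠ 0 → k₁ ≠ 0 → (∀ t : F, t • k₁ ≠ k₂) →
      (∀ u, φ (P + vecMulVec u z) - φ P ∈ Rvec y) →
      (∀ v, φ (P + vecMulVec k₁ v) - φ P ∈ Lvec x) →
      (∀ v, φ (P + vecMulVec k₂ v) - φ P ∈ Lvec x) → False :=
    fun z k₁ k₂ hz hk₁ hk hR h₁ h₂ =>
      not_line_and_point_mem_inter hx (hinj hz) hk₁ hk (fun t => hR _)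
        (fun t => by simpa only [smul_vecMulVec, vecMulVec_smul] using h₁ (t • z)) (hR _) (h₂ z)
  have hLR : ∀ z k₁ k₂ : Fin 2 → F, z ≠ 0 → k₁ ≠ 0 → (∀ t : F, t • k₁ ≠ k₂) →
      (∀ u, φ (P + vecMulVec u z) - φ P ∈ Lvec x) →
      (∀ v, φ (P + vecMulVec k₁ v) - φ P ∈ Rvec y) →
      (∀ v, φ (P + vecMulVec k₂ v) - φ P ∈ Rvec y) → False :=
    fun z k₁ k₂ hz hk₁ hk hL h₁ h₂ =>
      not_line_and_point_mem_inter hx (hinj hz) hk₁ hk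
        (fun t => by simpa only [smul_vecMulVec, vecMulVec_smul] using h₁ (t • z))
        (fun t => hL _) (h₂ z) (hL _)
  have hzero : ∀ u : Fin 2 → F, φ (P + vecMulVec u 0) - φ P = 0 := fun u => by simp
  by_cases hallR : ∀ z : Fin 2 → F, z ≠ 0 → ∀ u, φ (P + vecMulVec u z) - φ P ∈ Rvec y
  · refine .inl ⟨y, hy, fun u v => ?_⟩
    by_cases hv : v = 0
    · rw [hv, hzero]
      exact ⟨0, by simp⟩
    · exact hallR v hv u
  by_cases hallL : ∀ z : Fin 2 → F, z ≠ 0 → ∀ u, φ (P + vecMulVec u z) - φ P ∈ Lvec x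
  · refine .inr ⟨x, hx, fun u v => ?_⟩
    by_cases hv : v = 0
    · rw [hv, hzero]
      exact ⟨0, by simp⟩
    · exact hallL v hv u
  exfalso
  push Not at hallR hallL
  obtain ⟨z, hz, u, hu⟩ := hallR
  obtain ⟨z', hz', u', hu'⟩ := hallL
  have hzL := (hrow z hz).resolve_left fun h => hu (h u)
  have hzR := (hrow z' hz').resolve_right fun h => hu' (h u')
  have hn₁ : (![1, 0] : Fin 2 → F) ≠ 0 := fun h => by simpa using congrFun h 0
  have hn₂ : (![0, 1] : Fin 2 → F) ≠ 0 := fun h => by simpa using congrFun h 1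
  have hn₃ : (![1, 1] : Fin 2 → F) ≠ 0 := fun h => by simpa using congrFun h 0
  have h₁₂ : ∀ t : F, t • (![1, 0] : Fin 2 → F) ≠ ![0, 1] := fun t h => by
    simpa using congrFun h 1
  have h₁₃ : ∀ t : F, t • (![1, 0] : Fin 2 → F) ≠ ![1, 1] := fun t h => by
    simpa using congrFun h 1
  have h₂₃ : ∀ t : F, t • (![0, 1] : Fin 2 → F) ≠ ![1, 1] := fun t h => by
    simpa using congrFun h 0
  rcases hcol _ hn₁ with c₁ | c₁ <;> rcases hcol _ hn₂ with c₂ | c₂ <;>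
    rcases hcol _ hn₃ with c₃ | c₃
  · exact hLR z _ _ hz hn₁ h₁₂ hzL c₁ c₂
  · exact hLR z _ _ hz hn₁ h₁₂ hzL c₁ c₂
  · exact hLR z _ _ hz hn₁ h₁₃ hzL c₁ c₃
  · exact hRL z' _ _ hz' hn₂ h₂₃ hzR c₂ c₃
  · exact hLR z _ _ hz hn₂ h₂₃ hzL c₂ c₃
  · exact hRL z' _ _ hz' hn₁ h₁₃ hzR c₁ c₃
  · exact hRL z' _ _ hz' hn₁ h₁₂ hzR c₁ c₂
  · exact hRL z' _ _ hz' hn₁ h₁₂ hzR c₁ c₂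

/-- If every ball is mapped into a single arm and the ball around `0` is mapped into `R(y)`,
then the whole space is mapped into `R(y)`. -/
theorem mem_Rvec_of_forall_ball {F : Type*} [Field F] [Finite F] {p q : ℕ}
    {φ : Matrix (Fin 2) (Fin 2) F → Matrix (Fin p) (Fin q) F}
    (hφ : ∀ A B, Adjacent A B → φ A ≠ φ B)
    (hball : ∀ P,
      (∃ y : Fin q → F, y ≠ 0 ∧ ∀ u v, φ (P + vecMulVec u v) - φ P ∈ Rvec y) ∨
      (∃ x : Fin p → F, x ≠ 0 ∧ ∀ u v, φ (P + vecMulVec u v) - φ P ∈ Lvec x))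
    (h0 : φ 0 = 0) {y : Fin q → F} (hR : ∀ u v, φ (vecMulVec u v) ∈ Rvec y)
    (A : Matrix (Fin 2) (Fin 2) F) : φ A ∈ Rvec y := by
  set B : Matrix (Fin 2) (Fin 2) F := vecMulVec ![1, 0] (A 0) with hB
  have hA : A = B + vecMulVec ![0, 1] (A 1) := by
    ext i j
    rw [hB, Matrix.add_apply, vecMulVec_apply, vecMulVec_apply]
    fin_cases i <;> simp
  by_cases hrow : A 0 = 0
  · rw [hA, hB, hrow, vecMulVec_zero, zero_add]
    exact hR _ _
  have hn₁ : (![1, 0] : Fin 2 → F) ≠ 0 := fun h => by simpa using congrFun h 0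
  have h₁₂ : ∀ t : F, t • (![1, 0] : Fin 2 → F) ≠ ![0, 1] := fun t h => by
    simpa using congrFun h 1
  rcases hball B with ⟨y', -, h'⟩ | ⟨x, hx, hL⟩
  · have hadj : Adjacent B 0 := by
      simpa only [zero_add, zero_vecMulVec] using adjacent_add_vecMulVec_left 0 hn₁ hrow
    have hne : φ B ≠ 0 := h0 ▸ hφ _ _ hadj
    obtain ⟨u, hu⟩ := hR ![1, 0] (A 0)
    obtain ⟨w, hw⟩ := h' (-![1, 0]) (A 0)
    obtain ⟨a, ha⟩ := h' ![0, 1] (A 1)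
    rw [← hA] at ha
    rw [neg_vecMulVec, ← hB, add_neg_cancel, h0] at hw
    rw [← hB] at hu
    have hex : ∃ i, w i ≠ 0 := by
      by_contra! hw0
      refine hne (by ext i j; simpa [hw0] using hw i j)
    obtain ⟨i, hi⟩ := hex
    have hy' : ∀ j, y' j = -(u i / w i) * y j := fun j => by
      have := hw i j
      rw [Matrix.sub_apply, Matrix.zero_apply, hu] at this
      field_simp
      linear_combination -this
    refine ⟨fun k => u k - a k * (u i / w i), fun k j => ?_⟩
    have := ha k j
    rw [Matrix.sub_apply, hu, hy'] at this
    linear_combination this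
  · have hmem : ∀ u, φ (B + vecMulVec u (A 0)) - φ B ∈ Rvec y := fun u => by
      refine Rvec_sub_mem ?_ (hR _ _)
      rw [hB, ← add_vecMulVec]
      exact hR _ _
    exact (not_line_and_point_mem_inter hx (add_sub_injective_left hφ B hrow) hn₁ h₁₂
      (fun _ => hmem _) (fun _ => hL _ _) (hmem _) (hL _ _)).elim

theorem transpose_mem_Rvec {F : Type*} [Field F] {m n : ℕ} {x : Fin m → F}
    {M : Matrix (Fin m) (Fin n) F} (h : M ∈ Lvec x) : Mᵀ ∈ Rvec x := by
  obtain ⟨v, hv⟩ := h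
  exact ⟨v, fun i j => by rw [transpose_apply, hv, mul_comm]⟩

theorem transpose_mem_Lvec {F : Type*} [Field F] {m n : ℕ} {y : Fin n → F}
    {M : Matrix (Fin m) (Fin n) F} (h : M ∈ Rvec y) : Mᵀ ∈ Lvec y := by
  obtain ⟨u, hu⟩ := h
  exact ⟨u, fun i j => by rw [transpose_apply, hu, mul_comm]⟩

theorem rowRank_le_one_of_transpose_mem_Rvec {F : Type*} [Field F] {m n : ℕ} {x : Fin m → F}
    {M : Matrix (Fin m) (Fin n) F} (h : Mᵀ ∈ Rvec x) : rowRank M ≤ 1 := by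
  obtain ⟨v, hv⟩ := transpose_mem_Lvec h
  exact rowRank_le_one_of_mem_Rvec (y := v) ⟨x, hv⟩

/-- Proposition 4.3. -/
theorem stmt18 {F : Type*} [Field F] [Fintype F] (p q : ℕ) (hp : 2 ≤ p) (hq : 2 ≤ q)
    (φ : Matrix (Fin 2) (Fin 2) F → Matrix (Fin p) (Fin q) F)
    (hφ : ∀ A B, Adjacent A B → Adjacent (φ A) (φ B))
    (hdeg : Degenerate φ) (h0 : φ 0 = 0) :
    ∀ A : Matrix (Fin 2) (Fin 2) F, rowRank (φ A) ≤ 1 := by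
  intro A
  have hball := fun P => ball_subset_Rvec_or_Lvec hφ (hdeg P)
  have hne : ∀ A B, Adjacent A B → φ A ≠ φ B := fun A B h => (hφ A B h).ne
  rcases hball 0 with ⟨y, -, hR⟩ | ⟨x, -, hL⟩
  · exact rowRank_le_one_of_mem_Rvec (mem_Rvec_of_forall_ball hne hball h0
      (fun u v => by simpa [h0] using hR u v) A)
  · refine rowRank_le_one_of_transpose_mem_Rvec (mem_Rvec_of_forall_ball
      (φ := fun A => (φ A)ᵀ) (fun A B h e => hne A B h (transpose_injective e)) (fun P => ?_)
      (by simp [h0]) (fun u v => transpose_mem_Rvec (by simpa [h0] using hL u v)) A)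
    simp only [← transpose_sub]
    exact (hball P).symm.imp
      (fun ⟨x, hx, h⟩ => ⟨x, hx, fun u v => transpose_mem_Rvec (h u v)⟩)
      (fun ⟨y, hy, h⟩ => ⟨y, hy, fun u v => transpose_mem_Lvec (h u v)⟩)
end
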